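/- arXiv:2203.06057 — 3 statements merged into one kernel-verified Lean document; each statement's English description precedes it below -/
import Mathlib

section
/- Let λ be a Lévy measure on (0,∞) satisfying Condition (E). Suppose there is a slowly varying function ℓ such that λ̄(r) = ℓ(r) r^{-(1+2/d)} for all r ≥ 1, and assume ∫_1^∞ ℓ(u) u^{-1} du = ∞. Then, with L(r) = ∫_1^r ℓ(u) u^{-1} du, one has η̄(r) ~ L(r) r^{-1-2/d} / (d π κ (1+2/d)^{d/2}) as r → ∞. -/
open MeasureTheory Real Filter Set
open scoped ENNReal Topology

noncomputable section

/-- The heat kernel on `ℝ^d` with diffusion constant `κ`. -/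
def heatKernel (d : ℕ) (κ : ℝ) (s : ℝ) (x : EuclideanSpace ℝ (Fin d)) : ℝ :=
  (2 * π * κ * s) ^ (-(d : ℝ) / 2) * Real.exp (-‖x‖ ^ 2 / (2 * κ * s))

/-- A Lévy measure on `(0,∞)`: a nonzero Borel measure carried by `(0,∞)`
with `∫ min(1, z²) λ(dz) < ∞`. -/
def IsLevyMeasure (lam : Measure ℝ) : Prop :=
  lam ≠ 0 ∧ lam (Set.Iic 0) = 0 ∧
    ∫⁻ z in Set.Ioi (0 : ℝ), ENNReal.ofReal (min 1 (z ^ 2)) ∂lam < ⊤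

/-- `η̄(r) = (Leb ⊗ Leb ⊗ λ)({(s,y,z) ∈ (0,t] × ℝ^d × (0,∞) : g(s,y) z > r})`. -/
def etaBar (d : ℕ) (κ t : ℝ) (lam : Measure ℝ) (r : ℝ) : ℝ≥0∞ :=
  (volume.prod (volume.prod lam))
    {p : ℝ × (EuclideanSpace ℝ (Fin d)) × ℝ |
      p.1 ∈ Set.Ioc (0 : ℝ) t ∧ p.2.2 ∈ Set.Ioi (0 : ℝ) ∧
        r < heatKernel d κ p.1 p.2.1 * p.2.2}

/-- `η̄₀(r)`, the analogue of `η̄` with the restriction `|y| ≤ 1/2`. -/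
def etaBar0 (d : ℕ) (κ t : ℝ) (lam : Measure ℝ) (r : ℝ) : ℝ≥0∞ :=
  (volume.prod (volume.prod lam))
    {p : ℝ × (EuclideanSpace ℝ (Fin d)) × ℝ |
      p.1 ∈ Set.Ioc (0 : ℝ) t ∧ p.2.2 ∈ Set.Ioi (0 : ℝ) ∧ ‖p.2.1‖ ≤ 1 / 2 ∧
        r < heatKernel d κ p.1 p.2.1 * p.2.2}

/-- `η̄_A(r)`, where the heat kernel is evaluated at `dist(y, A)`. -/
def etaBarA (d : ℕ) (κ t : ℝ) (lam : Measure ℝ)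
    (A : Set (EuclideanSpace ℝ (Fin d))) (r : ℝ) : ℝ≥0∞ :=
  (volume.prod (volume.prod lam))
    {p : ℝ × (EuclideanSpace ℝ (Fin d)) × ℝ |
      p.1 ∈ Set.Ioc (0 : ℝ) t ∧ p.2.2 ∈ Set.Ioi (0 : ℝ) ∧
        r < (2 * π * κ * p.1) ^ (-(d : ℝ) / 2) *
            Real.exp (-(Metric.infDist p.2.1 A) ^ 2 / (2 * κ * p.1)) * p.2.2}

/-- `τ̄(r) = (Leb ⊗ λ)({(s,z) ∈ (0,t] × (0,∞) : (2πκs)^{-d/2} z > r})`. -/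
def tauBar (d : ℕ) (κ t : ℝ) (lam : Measure ℝ) (r : ℝ) : ℝ≥0∞ :=
  (volume.prod lam)
    {p : ℝ × ℝ | p.1 ∈ Set.Ioc (0 : ℝ) t ∧ p.2 ∈ Set.Ioi (0 : ℝ) ∧
      r < (2 * π * κ * p.1) ^ (-(d : ℝ) / 2) * p.2}

/-- The truncated moment `M_γ(x) = ∫_{(0,x]} z^γ λ(dz)`. -/
def Mgamma (lam : Measure ℝ) (γ x : ℝ) : ℝ≥0∞ :=
  ∫⁻ z in Set.Ioc (0 : ℝ) x, ENNReal.ofReal (z ^ γ) ∂lam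

/-- A measurable function, positive on `[1,∞)`, is slowly varying at infinity if
`ℓ(cx)/ℓ(x) → 1` as `x → ∞` for every `c > 0`. -/
def SlowlyVarying (ℓ : ℝ → ℝ) : Prop :=
  Measurable ℓ ∧ (∀ x ≥ (1 : ℝ), 0 < ℓ x) ∧
    ∀ c > (0 : ℝ), Tendsto (fun x => ℓ (c * x) / ℓ x) atTop (𝓝 1)

/-- Regular variation at infinity with index `-α`: `f` is eventually positive and
`f(cr)/f(r) → c^{-α}` as `r → ∞` for every `c > 0`. -/
def RegVaryNeg (f : ℝ → ℝ) (α : ℝ) : Prop :=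
  (∀ᶠ r in atTop, 0 < f r) ∧
    ∀ c > (0 : ℝ), Tendsto (fun r => f (c * r) / f r) atTop (𝓝 (c ^ (-α)))

/-- Condition (E): the necessary and sufficient condition for existence of the solution. -/
def ConditionE (d : ℕ) (lam : Measure ℝ) : Prop :=
  (∫⁻ z in Set.Ioi (1 : ℝ), ENNReal.ofReal (Real.log z ^ ((d : ℝ) / 2)) ∂lam < ⊤) ∧
  (d = 1 → ∫⁻ z in Set.Ioc (0 : ℝ) 1, ENNReal.ofReal (z ^ 2) ∂lam < ⊤) ∧
  (d = 2 → ∫⁻ z in Set.Ioc (0 : ℝ) 1, ENNReal.ofReal (z ^ 2 * |Real.log z|) ∂lam < ⊤) ∧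
  (3 ≤ d → ∫⁻ z in Set.Ioc (0 : ℝ) 1, ENNReal.ofReal (z ^ (1 + 2 / (d : ℝ))) ∂lam < ⊤)

/-- Condition (F): `∫_{(0,1)} z^{2/d} λ(dz) < ∞` if `d ≠ 2`,
and `∫_{(0,1)} z |log z| λ(dz) < ∞` if `d = 2`. -/
def ConditionF (d : ℕ) (lam : Measure ℝ) : Prop :=
  (d ≠ 2 → ∫⁻ z in Set.Ioo (0 : ℝ) 1, ENNReal.ofReal (z ^ ((2 : ℝ) / d)) ∂lam < ⊤) ∧
  (d = 2 → ∫⁻ z in Set.Ioo (0 : ℝ) 1, ENNReal.ofReal (z * |Real.log z|) ∂lam < ⊤)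

/-- The tails of a Lévy measure are finite. -/
theorem IsLevyMeasure.measure_Ioi_lt_top {lam : Measure ℝ} (h : IsLevyMeasure lam) {a : ℝ}
    (ha : 0 < a) : lam (Ioi a) < ⊤ := by
  have hm : 0 < min 1 (a ^ 2) := by positivity
  have hle : ENNReal.ofReal (min 1 (a ^ 2)) * lam (Ioi a)
      ≤ ∫⁻ z in Ioi (0 : ℝ), ENNReal.ofReal (min 1 (z ^ 2)) ∂lam := by
    rw [← setLIntegral_const]
    refine (setLIntegral_mono_ae' measurableSet_Ioi ?_).trans
      (lintegral_mono_set (Ioi_subset_Ioi ha.le))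
    refine Eventually.of_forall fun z hz => ENNReal.ofReal_le_ofReal ?_
    have : a < z := hz
    gcongr
  by_contra hcon
  rw [not_lt_top_iff] at hcon
  rw [hcon, ENNReal.mul_top (ENNReal.ofReal_pos.2 hm).ne'] at hle
  exact absurd h.2.2 (not_lt.mpr hle)

theorem IsLevyMeasure.sigmaFinite {lam : Measure ℝ} (h : IsLevyMeasure lam) :
    SigmaFinite lam := by
  refine ⟨⟨⟨fun n : ℕ => Iic 0 ∪ Ioi (1 / ((n : ℝ) + 1)), fun _ => trivial, fun n => ?_, ?_⟩⟩⟩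
  · refine (measure_union_le _ _).trans_lt ?_
    rw [h.2.1, zero_add]
    exact h.measure_Ioi_lt_top (by positivity)
  · refine eq_univ_of_forall fun x => mem_iUnion.2 ?_
    rcases le_or_gt x 0 with hx | hx
    · exact ⟨0, Or.inl hx⟩
    · obtain ⟨n, hn⟩ := exists_nat_one_div_lt hx
      exact ⟨n, Or.inr hn⟩

/-- The volume of the unit ball of `ℝ^d`. -/
def unitBallVolume (d : ℕ) : ℝ := √π ^ d / Real.Gamma ((d : ℝ) / 2 + 1)

theorem unitBallVolume_pos (d : ℕ) : 0 < unitBallVolume d := by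
  unfold unitBallVolume
  have := Real.Gamma_pos_of_pos (show (0 : ℝ) < (d : ℝ) / 2 + 1 by positivity)
  have := Real.pi_pos
  positivity

/-- Superlevel sets of the heat kernel at a fixed time are balls. -/
theorem setOf_lt_heatKernel_mul {d : ℕ} (hd : 1 ≤ d) {κ r z s : ℝ} (hκ : 0 < κ) (hr : 0 < r)
    (hz : 0 < z) (hs : 0 < s) :
    {y : EuclideanSpace ℝ (Fin d) | r < heatKernel d κ s y * z} =
      Metric.ball 0
        (√(d * κ * s * Real.log ((z / r) ^ (2 / (d : ℝ)) / (2 * π * κ) / s))) := by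
  have hd0 : (0 : ℝ) < d := by exact_mod_cast hd
  have hpi := Real.pi_pos
  ext y
  rw [mem_ofPred_eq, mem_ball_zero_iff, Real.lt_sqrt (norm_nonneg y), heatKernel]
  have h1 : r < (2 * π * κ * s) ^ (-(d : ℝ) / 2) * Real.exp (-‖y‖ ^ 2 / (2 * κ * s)) * z ↔
      Real.log r < -(d : ℝ) / 2 * Real.log (2 * π * κ * s) + -‖y‖ ^ 2 / (2 * κ * s)
        + Real.log z := by
    rw [← Real.log_lt_log_iff hr (by positivity), Real.log_mul (by positivity) hz.ne',
      Real.log_mul (by positivity) (by positivity), Real.log_exp, Real.log_rpow (by positivity)]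
  have h2 : Real.log ((z / r) ^ (2 / (d : ℝ)) / (2 * π * κ) / s) =
      2 / (d : ℝ) * (Real.log z - Real.log r) - Real.log (2 * π * κ * s) := by
    rw [div_div, Real.log_div (by positivity) (by positivity), Real.log_rpow (by positivity),
      Real.log_div hz.ne' hr.ne']
  rw [h1, h2]
  have h3 : d * κ * s * (2 / (d : ℝ) * (Real.log z - Real.log r) - Real.log (2 * π * κ * s)) =
      2 * κ * s * (Real.log z - Real.log r - (d : ℝ) / 2 * Real.log (2 * π * κ * s)) := by
    field_simp
  rw [h3, ← div_lt_iff₀' (by positivity : 0 < 2 * κ * s), neg_div, neg_div]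
  constructor <;> intro h <;> linarith

theorem volume_setOf_lt_heatKernel_mul {d : ℕ} (hd : 1 ≤ d) {κ r z s : ℝ} (hκ : 0 < κ)
    (hr : 0 < r) (hz : 0 < z) (hs : 0 < s) :
    volume {y : EuclideanSpace ℝ (Fin d) | r < heatKernel d κ s y * z} =
      ENNReal.ofReal (unitBallVolume d * √(d * κ * s *
        Real.log ((z / r) ^ (2 / (d : ℝ)) / (2 * π * κ) / s)) ^ d) := by
  have : Nonempty (Fin d) := ⟨⟨0, hd⟩⟩
  rw [setOf_lt_heatKernel_mul hd hκ hr hz hs, EuclideanSpace.volume_ball, Fintype.card_fin,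
    mul_comm, ← ENNReal.ofReal_pow (Real.sqrt_nonneg _),
    ENNReal.ofReal_mul (unitBallVolume_pos d).le, unitBallVolume]

/-- `∫_0^w (c s log(w/s))^{d/2} ds`, evaluated through the substitution `s = w e^{-v}`. -/
theorem lintegral_sqrt_mul_log_pow (d : ℕ) {c w : ℝ} (hc : 0 < c) (hw : 0 < w) :
    ∫⁻ s in Ioo 0 w, ENNReal.ofReal (√(c * s * Real.log (w / s)) ^ d) =
      ENNReal.ofReal (c ^ ((d : ℝ) / 2) * w ^ ((d : ℝ) / 2 + 1) *
        ((1 / ((d : ℝ) / 2 + 1)) ^ ((d : ℝ) / 2 + 1) * Real.Gamma ((d : ℝ) / 2 + 1))) := by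
  have himg : (fun v : ℝ => w * Real.exp (-v)) '' Ioi 0 = Ioo 0 w := by
    ext s
    constructor
    · rintro ⟨v, hv, rfl⟩
      have hv' : (0 : ℝ) < v := hv
      refine ⟨by positivity, ?_⟩
      have : Real.exp (-v) < 1 := by simpa using hv'
      exact mul_lt_of_lt_one_right hw this
    · rintro ⟨h0, h1⟩
      refine ⟨Real.log (w / s), Real.log_pos ((one_lt_div h0).2 h1), ?_⟩
      simp only
      rw [Real.exp_neg, Real.exp_log (by positivity)]
      field_simp
  have hderiv : ∀ v ∈ Ioi (0 : ℝ),
      HasDerivWithinAt (fun v : ℝ => w * Real.exp (-v)) (-(w * Real.exp (-v))) (Ioi 0) v := by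
    intro v _
    simpa using ((hasDerivAt_neg v).exp.const_mul w).hasDerivWithinAt (s := Ioi 0)
  have hinj : InjOn (fun v : ℝ => w * Real.exp (-v)) (Ioi 0) := by
    intro a _ b _ hab
    have := mul_left_cancel₀ hw.ne' hab
    simpa using this
  rw [← himg, lintegral_image_eq_lintegral_abs_deriv_mul measurableSet_Ioi hderiv hinj]
  have hpt : ∀ v ∈ Ioi (0 : ℝ),
      ENNReal.ofReal |-(w * Real.exp (-v))| * ENNReal.ofReal
        (√(c * (w * Real.exp (-v)) * Real.log (w / (w * Real.exp (-v)))) ^ d) =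
      ENNReal.ofReal (c ^ ((d : ℝ) / 2) * w ^ ((d : ℝ) / 2 + 1)) * ENNReal.ofReal
        (v ^ ((d : ℝ) / 2 + 1 - 1) * Real.exp (-(((d : ℝ) / 2 + 1) * v))) := by
    intro v hv
    have hv' : (0 : ℝ) < v := hv
    have hlog : Real.log (w / (w * Real.exp (-v))) = v := by
      rw [div_mul_eq_div_div, div_self hw.ne', one_div, ← Real.exp_neg, neg_neg, Real.log_exp]
    rw [hlog, abs_neg, abs_of_pos (by positivity), ← ENNReal.ofReal_mul (by positivity),
      ← ENNReal.ofReal_mul (by positivity)]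
    congr 1
    have hsq : √(c * (w * Real.exp (-v)) * v) ^ d =
        c ^ ((d : ℝ) / 2) * (w ^ ((d : ℝ) / 2) * Real.exp (-v * ((d : ℝ) / 2))) *
          v ^ ((d : ℝ) / 2) := by
      rw [Real.sqrt_eq_rpow, ← Real.rpow_natCast, ← Real.rpow_mul (by positivity),
        Real.mul_rpow (by positivity) hv'.le, Real.mul_rpow hc.le (by positivity),
        Real.mul_rpow hw.le (by positivity), Real.exp_mul]
      ring_nf
    have he : Real.exp (-(((d : ℝ) / 2 + 1) * v)) =
        Real.exp (-v) * Real.exp (-v * ((d : ℝ) / 2)) := by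
      rw [← Real.exp_add]; ring_nf
    rw [hsq, he, Real.rpow_add hw, Real.rpow_one, add_sub_cancel_right]
    ring
  rw [setLIntegral_congr_fun measurableSet_Ioi hpt, lintegral_const_mul' _ _ ENNReal.ofReal_ne_top,
    ← ofReal_integral_eq_lintegral_ofReal, Real.integral_rpow_mul_exp_neg_mul_Ioi
      (by positivity) (by positivity), ← ENNReal.ofReal_mul (by positivity)]
  · have := integrableOn_rpow_mul_exp_neg_mul_rpow (s := (d : ℝ) / 2 + 1 - 1) (p := 1)
      (b := (d : ℝ) / 2 + 1) (by have : (0 : ℝ) ≤ d := by positivity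
                                 linarith) (by norm_num) (by positivity)
    simpa only [IntegrableOn, neg_mul, Real.rpow_one] using this
  · refine (ae_restrict_iff' measurableSet_Ioi).2 (Eventually.of_forall fun v hv => ?_)
    have hv' : (0 : ℝ) < v := hv
    simp only [Pi.zero_apply]
    positivity

theorem measurableSet_setOf_lt_heatKernel (d : ℕ) (κ t r : ℝ) :
    MeasurableSet {p : ℝ × (EuclideanSpace ℝ (Fin d)) × ℝ |
      p.1 ∈ Ioc (0 : ℝ) t ∧ p.2.2 ∈ Ioi (0 : ℝ) ∧ r < heatKernel d κ p.1 p.2.1 * p.2.2} := by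
  have hk : Measurable fun p : ℝ × (EuclideanSpace ℝ (Fin d)) × ℝ =>
      heatKernel d κ p.1 p.2.1 * p.2.2 := by
    unfold heatKernel
    fun_prop
  exact (measurable_fst measurableSet_Ioc).inter
    ((measurable_snd.snd measurableSet_Ioi).inter (measurableSet_lt measurable_const hk))

/-- The jump-size slice of `η̄`, namely `∫_0^t Leb {y | g(s,y) z > r} ds`. -/
def etaSlice (d : ℕ) (κ t r z : ℝ) : ℝ≥0∞ :=
  ∫⁻ s in Ioc 0 t, volume {y : EuclideanSpace ℝ (Fin d) | r < heatKernel d κ s y * z}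

theorem etaBar_eq_lintegral_etaSlice (d : ℕ) (κ t : ℝ) (lam : Measure ℝ) [SigmaFinite lam]
    (r : ℝ) : etaBar d κ t lam r = ∫⁻ z in Ioi 0, etaSlice d κ t r z ∂lam := by
  have hS := measurableSet_setOf_lt_heatKernel d κ t r
  rw [etaBar, ← Measure.prodAssoc_prod, Measure.map_apply MeasurableEquiv.prodAssoc.measurable hS,
    Measure.prod_apply_symm (MeasurableEquiv.prodAssoc.measurable hS),
    ← lintegral_indicator measurableSet_Ioi]
  refine lintegral_congr fun z => ?_
  rw [Measure.prod_apply (measurable_prodMk_right (MeasurableEquiv.prodAssoc.measurable hS))]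
  by_cases hz : z ∈ Ioi (0 : ℝ)
  · rw [indicator_of_mem hz, etaSlice, ← lintegral_indicator measurableSet_Ioc]
    refine lintegral_congr fun s => ?_
    by_cases hs : s ∈ Ioc 0 t
    · rw [indicator_of_mem hs]
      congr 1
      ext y
      simp only [mem_preimage, mem_ofPred_eq, MeasurableEquiv.prodAssoc, MeasurableEquiv.coe_mk,
        Equiv.prodAssoc_apply]
      exact ⟨fun h => h.2.2, fun h => ⟨hs, hz, h⟩⟩
    · rw [indicator_of_notMem hs]
      convert measure_empty (μ := (volume : Measure (EuclideanSpace ℝ (Fin d))))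
      ext y
      simp only [mem_preimage, mem_ofPred_eq, MeasurableEquiv.prodAssoc, MeasurableEquiv.coe_mk,
        Equiv.prodAssoc_apply, mem_empty_iff_false, iff_false]
      exact fun h => hs h.1
  · rw [indicator_of_notMem hz]
    refine (lintegral_congr fun s => ?_).trans lintegral_zero
    convert measure_empty (μ := (volume : Measure (EuclideanSpace ℝ (Fin d))))
    ext y
    simp only [mem_preimage, mem_ofPred_eq, MeasurableEquiv.prodAssoc, MeasurableEquiv.coe_mk,
      Equiv.prodAssoc_apply, mem_empty_iff_false, iff_false]
    exact fun h => hz h.2.1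

theorem rpow_two_div_div_rpow (d : ℕ) {x κ : ℝ} (hx : 0 < x) (hκ : 0 < κ) (p : ℝ) :
    (x ^ (2 / (d : ℝ)) / (2 * π * κ)) ^ p =
      x ^ (2 / (d : ℝ) * p) / (2 * π * κ) ^ p := by
  have hpi := Real.pi_pos
  rw [Real.div_rpow (by positivity) (by positivity), ← Real.rpow_mul hx.le]

/-- The slice in closed form, for jumps small enough not to feel the time horizon `t`. -/
theorem etaSlice_eq {d : ℕ} (hd : 1 ≤ d) {κ t r z : ℝ} (hκ : 0 < κ) (hr : 0 < r) (hz : 0 < z)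
    (hw : (z / r) ^ (2 / (d : ℝ)) / (2 * π * κ) ≤ t) :
    etaSlice d κ t r z = ENNReal.ofReal
      (((d : ℝ) * π * κ * (1 + 2 / (d : ℝ)) ^ ((d : ℝ) / 2))⁻¹ / (1 + 2 / (d : ℝ)) *
        (z / r) ^ (1 + 2 / (d : ℝ))) := by
  have hd0 : (0 : ℝ) < d := by exact_mod_cast hd
  have hpi := Real.pi_pos
  set w := (z / r) ^ (2 / (d : ℝ)) / (2 * π * κ) with hwdef
  have hw0 : 0 < w := by positivity
  have hsplit : etaSlice d κ t r z = ∫⁻ s in Ioo 0 w, ENNReal.ofReal (unitBallVolume d) *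
      ENNReal.ofReal (√(d * κ * s * Real.log (w / s)) ^ d) := by
    rw [etaSlice, ← lintegral_indicator measurableSet_Ioc, ← lintegral_indicator measurableSet_Ioo]
    refine lintegral_congr fun s => ?_
    by_cases hs : s ∈ Ioo 0 w
    · rw [indicator_of_mem hs, indicator_of_mem (show s ∈ Ioc 0 t from ⟨hs.1, hs.2.le.trans hw⟩),
        volume_setOf_lt_heatKernel_mul hd hκ hr hz hs.1, ENNReal.ofReal_mul
        (unitBallVolume_pos d).le]
    · rw [indicator_of_notMem hs]
      by_cases hs' : s ∈ Ioc 0 t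
      · have hws : w ≤ s := not_lt.1 fun h => hs ⟨hs'.1, h⟩
        rw [indicator_of_mem hs', volume_setOf_lt_heatKernel_mul hd hκ hr hz hs'.1,
          Real.sqrt_eq_zero_of_nonpos, zero_pow (by omega), mul_zero, ENNReal.ofReal_zero]
        have := Real.log_nonpos (by have := hs'.1; positivity) ((div_le_one hs'.1).2 hws)
        exact mul_nonpos_of_nonneg_of_nonpos (by have := hs'.1; positivity) this
      · rw [indicator_of_notMem hs']
  rw [hsplit, lintegral_const_mul' _ _ ENNReal.ofReal_ne_top,
    lintegral_sqrt_mul_log_pow d (by positivity) hw0,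
    ← ENNReal.ofReal_mul (unitBallVolume_pos d).le]
  congr 1
  have hG := Real.Gamma_pos_of_pos (show (0 : ℝ) < (d : ℝ) / 2 + 1 by positivity)
  have e1 : 2 / (d : ℝ) * ((d : ℝ) / 2 + 1) = 1 + 2 / (d : ℝ) := by field_simp
  have e2 : √π ^ d = π ^ ((d : ℝ) / 2) := by
    rw [Real.sqrt_eq_rpow, ← Real.rpow_natCast, ← Real.rpow_mul (by positivity)]
    ring_nf
  have e3 : (d : ℝ) / 2 + 1 = (d : ℝ) / 2 * (1 + 2 / (d : ℝ)) := by field_simp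
  have e4 : (2 * π * κ) ^ ((d : ℝ) / 2 + 1) = (2 : ℝ) ^ ((d : ℝ) / 2) * π ^ ((d : ℝ) / 2) *
      κ ^ ((d : ℝ) / 2) * (2 * π * κ) := by
    rw [Real.rpow_add (by positivity), Real.rpow_one, Real.mul_rpow (by positivity) hκ.le,
      Real.mul_rpow (by positivity) hpi.le]
  have e5 : (1 / ((d : ℝ) / 2 + 1)) ^ ((d : ℝ) / 2 + 1) = (2 : ℝ) ^ ((d : ℝ) / 2) /
      ((d : ℝ) ^ ((d : ℝ) / 2) * (1 + 2 / (d : ℝ)) ^ ((d : ℝ) / 2) *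
      ((d : ℝ) / 2 * (1 + 2 / (d : ℝ)))) := by
    rw [Real.div_rpow zero_le_one (by positivity), Real.one_rpow, Real.rpow_add (by positivity),
      Real.rpow_one, e3, Real.mul_rpow (by positivity) (by positivity),
      Real.div_rpow (by positivity) (by positivity)]
    field_simp
  rw [hwdef, rpow_two_div_div_rpow d (by positivity) hκ, e1, unitBallVolume, e2, e4, e5,
    Real.mul_rpow hd0.le hκ.le]
  generalize (z / r) ^ (1 + 2 / (d : ℝ)) = Z
  have p1 : 0 < (1 + 2 / (d : ℝ)) ^ ((d : ℝ) / 2) := by positivity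
  have p2 : 0 < 1 + 2 / (d : ℝ) := by positivity
  generalize (1 + 2 / (d : ℝ)) ^ ((d : ℝ) / 2) = P at *
  generalize 1 + 2 / (d : ℝ) = g at *
  have p3 : 0 < (d : ℝ) ^ ((d : ℝ) / 2) := by positivity
  have p4 : 0 < (2 : ℝ) ^ ((d : ℝ) / 2) := by positivity
  have p5 : 0 < π ^ ((d : ℝ) / 2) := by positivity
  have p6 : 0 < κ ^ ((d : ℝ) / 2) := by positivity
  generalize (d : ℝ) ^ ((d : ℝ) / 2) = D at *
  generalize (2 : ℝ) ^ ((d : ℝ) / 2) = B at *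
  generalize π ^ ((d : ℝ) / 2) = Q at *
  generalize κ ^ ((d : ℝ) / 2) = J at *
  generalize Real.Gamma ((d : ℝ) / 2 + 1) = G at *
  field_simp

/-- The slice grows at most linearly in the jump size. -/
theorem etaSlice_le {d : ℕ} (hd : 1 ≤ d) {κ t r z : ℝ} (hκ : 0 < κ) (ht : 0 < t) (hr : 0 < r)
    (hz : 0 < z) :
    etaSlice d κ t r z ≤ ENNReal.ofReal
      (unitBallVolume d * ((d : ℝ) * κ / (2 * π * κ)) ^ ((d : ℝ) / 2) * t / r) *
        ENNReal.ofReal z := by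
  have hd0 : (0 : ℝ) < d := by exact_mod_cast hd
  have hpi := Real.pi_pos
  have hV := unitBallVolume_pos d
  have hbound : etaSlice d κ t r z ≤ ∫⁻ _ in Ioc 0 t, ENNReal.ofReal (unitBallVolume d *
      (((d : ℝ) * κ / (2 * π * κ)) ^ ((d : ℝ) / 2) * (z / r))) := by
    refine setLIntegral_mono' measurableSet_Ioc fun s hs => ?_
    have hs0 := hs.1
    rw [volume_setOf_lt_heatKernel_mul hd hκ hr hz hs0]
    gcongr
    set w := (z / r) ^ (2 / (d : ℝ)) / (2 * π * κ) with hwdef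
    have hw0 : 0 < w := by positivity
    calc √(d * κ * s * Real.log (w / s)) ^ d ≤ √(d * κ * w) ^ d := by
          refine pow_le_pow_left₀ (Real.sqrt_nonneg _) (Real.sqrt_le_sqrt ?_) d
          calc d * κ * s * Real.log (w / s) ≤ d * κ * s * (w / s) :=
                mul_le_mul_of_nonneg_left (Real.log_le_self (by positivity)) (by positivity)
            _ = d * κ * w := by field_simp
      _ = ((d : ℝ) * κ / (2 * π * κ)) ^ ((d : ℝ) / 2) * (z / r) := by
          rw [Real.sqrt_eq_rpow, ← Real.rpow_natCast, ← Real.rpow_mul (by positivity),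
            show (1 / 2 : ℝ) * d = d / 2 by ring, Real.mul_rpow (by positivity) hw0.le,
            Real.div_rpow (by positivity : 0 ≤ (d : ℝ) * κ) (by positivity), hwdef,
            rpow_two_div_div_rpow d (by positivity) hκ,
            show 2 / (d : ℝ) * (d / 2) = 1 by field_simp, Real.rpow_one]
          ring
  refine hbound.trans_eq ?_
  rw [setLIntegral_const, Real.volume_Ioc, sub_zero, ← ENNReal.ofReal_mul (by positivity),
    ← ENNReal.ofReal_mul (by positivity)]
  congr 1
  ring

section SlowlyVaryingTail

variable {lam : Measure ℝ} {γ : ℝ} {ℓ : ℝ → ℝ}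

theorem measure_Ioi_eq_ofReal (hfin : ∀ a > 0, lam (Ioi a) < ⊤)
    (hrep : ∀ r ≥ (1 : ℝ), (lam (Ioi r)).toReal = ℓ r * r ^ (-γ)) {r : ℝ} (hr : 1 ≤ r) :
    lam (Ioi r) = ENNReal.ofReal (ℓ r * r ^ (-γ)) := by
  rw [← hrep r hr, ENNReal.ofReal_toReal (hfin r (by linarith)).ne]

theorem tail_antitone (hfin : ∀ a > 0, lam (Ioi a) < ⊤)
    (hrep : ∀ r ≥ (1 : ℝ), (lam (Ioi r)).toReal = ℓ r * r ^ (-γ)) {u r : ℝ} (hu : 1 ≤ u)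
    (hur : u ≤ r) : ℓ r * r ^ (-γ) ≤ ℓ u * u ^ (-γ) := by
  rw [← hrep u hu, ← hrep r (hu.trans hur)]
  exact ENNReal.toReal_mono (hfin u (by linarith)).ne (measure_mono (Ioi_subset_Ioi hur))

theorem measure_Ioc_eq_ofReal (hfin : ∀ a > 0, lam (Ioi a) < ⊤)
    (hrep : ∀ r ≥ (1 : ℝ), (lam (Ioi r)).toReal = ℓ r * r ^ (-γ)) (hℓ : SlowlyVarying ℓ)
    {u r : ℝ} (hu : 1 ≤ u) (hur : u ≤ r) :
    lam (Ioc u r) = ENNReal.ofReal (ℓ u * u ^ (-γ) - ℓ r * r ^ (-γ)) := by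
  have hr : 1 ≤ r := hu.trans hur
  have h0 : 0 ≤ ℓ r * r ^ (-γ) := mul_nonneg (hℓ.2.1 r hr).le (by positivity)
  rw [← Ioi_sdiff_Ioi, measure_sdiff (Ioi_subset_Ioi hur) measurableSet_Ioi.nullMeasurableSet
    (hfin r (by linarith)).ne, measure_Ioi_eq_ofReal hfin hrep hu,
    measure_Ioi_eq_ofReal hfin hrep hr, ENNReal.ofReal_sub _ h0]

/-- Under regular variation of index `-γ < -1`, the first moment of the tail is controlled by
the tail. -/
theorem exists_lintegral_Ioi_le (hγ : 1 < γ) (hfin : ∀ a > 0, lam (Ioi a) < ⊤)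
    (hrep : ∀ r ≥ (1 : ℝ), (lam (Ioi r)).toReal = ℓ r * r ^ (-γ)) (hℓ : SlowlyVarying ℓ) :
    ∃ K : ℝ, 0 ≤ K ∧ ∀ᶠ R in atTop,
      ∫⁻ z in Ioi R, ENNReal.ofReal z ∂lam ≤ ENNReal.ofReal (K * (ℓ R * R ^ (1 - γ))) := by
  have h21 : (2 : ℝ) ^ (1 - γ) < 1 :=
    Real.rpow_lt_one_of_one_lt_of_neg (by norm_num) (by linarith)
  obtain ⟨θ, hθ, hθ1⟩ := exists_between h21
  have hpos : (0 : ℝ) < 2 ^ (1 - γ) := by positivity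
  have hθ0 : 0 < θ := hpos.trans hθ
  have hdoubling : ∀ᶠ R in atTop, ℓ (2 * R) / ℓ R < θ / 2 ^ (1 - γ) :=
    (hℓ.2.2 2 (by norm_num)).eventually (eventually_lt_nhds ((one_lt_div hpos).2 hθ))
  obtain ⟨R₀, hR₀⟩ := eventually_atTop.1 hdoubling
  refine ⟨2 / (1 - θ), div_nonneg (by norm_num) (by linarith), ?_⟩
  filter_upwards [eventually_ge_atTop R₀, eventually_ge_atTop 1] with R hR hR1
  have hR0 : 0 < R := by linarith
  have hstep : ∀ u, R ≤ u → 2 * (ℓ (2 * u) * (2 * u) ^ (-γ)) ≤ θ * (ℓ u * u ^ (-γ)) := by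
    intro u hu
    have hu0 : 0 < u := by linarith
    have hℓu := hℓ.2.1 u (hR1.trans hu)
    have h := (hR₀ u (hR.trans hu)).le
    rw [div_le_div_iff₀ hℓu hpos] at h
    have e : (2 : ℝ) ^ (1 - γ) = 2 * 2 ^ (-γ) := by
      rw [sub_eq_add_neg, Real.rpow_add (by norm_num), Real.rpow_one]
    rw [Real.mul_rpow (by norm_num) hu0.le]
    calc 2 * (ℓ (2 * u) * (2 ^ (-γ) * u ^ (-γ))) = ℓ (2 * u) * 2 ^ (1 - γ) * u ^ (-γ) := by
          rw [e]; ring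
      _ ≤ θ * ℓ u * u ^ (-γ) := by gcongr
      _ = _ := by ring
  have hge : ∀ k : ℕ, R ≤ 2 ^ k * R := fun k =>
    le_mul_of_one_le_left hR0.le (one_le_pow₀ (by norm_num))
  have hgeom : ∀ k : ℕ, 2 ^ k * (ℓ (2 ^ k * R) * (2 ^ k * R) ^ (-γ)) ≤
      θ ^ k * (ℓ R * R ^ (-γ)) := by
    intro k
    induction k with
    | zero => simp
    | succ k ih =>
      have h := hstep _ (hge k)
      have e : (2 : ℝ) ^ (k + 1) * R = 2 * (2 ^ k * R) := by ring
      rw [e]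
      calc (2 : ℝ) ^ (k + 1) * (ℓ (2 * (2 ^ k * R)) * (2 * (2 ^ k * R)) ^ (-γ))
          = 2 ^ k * (2 * (ℓ (2 * (2 ^ k * R)) * (2 * (2 ^ k * R)) ^ (-γ))) := by ring
        _ ≤ 2 ^ k * (θ * (ℓ (2 ^ k * R) * (2 ^ k * R) ^ (-γ))) := by gcongr
        _ = θ * (2 ^ k * (ℓ (2 ^ k * R) * (2 ^ k * R) ^ (-γ))) := by ring
        _ ≤ θ * (θ ^ k * (ℓ R * R ^ (-γ))) := by gcongr
        _ = _ := by ring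
  have hcover : Ioi R ⊆ ⋃ k : ℕ, Ioc (2 ^ k * R) (2 ^ (k + 1) * R) := by
    intro z hz
    have hz' : R < z := hz
    have hex : ∃ k : ℕ, z ≤ 2 ^ k * R := by
      obtain ⟨k, hk⟩ := pow_unbounded_of_one_lt (z / R) (one_lt_two (α := ℝ))
      exact ⟨k, ((div_lt_iff₀ hR0).1 hk).le⟩
    classical
    obtain ⟨k, hk⟩ := Nat.exists_eq_succ_of_ne_zero (n := Nat.find hex) fun h => by
      have := Nat.find_spec hex
      rw [h, pow_zero, one_mul] at this
      exact absurd this (not_le.2 hz')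
    refine mem_iUnion.2 ⟨k, not_le.1 (Nat.find_min hex (by omega)), ?_⟩
    have := Nat.find_spec hex
    rwa [hk] at this
  have hTR : 0 ≤ ℓ R * R ^ (-γ) := mul_nonneg (hℓ.2.1 R hR1).le (by positivity)
  have hpiece : ∀ k : ℕ, ∫⁻ z in Ioc (2 ^ k * R) (2 ^ (k + 1) * R), ENNReal.ofReal z ∂lam ≤
      ENNReal.ofReal (2 * R * (ℓ R * R ^ (-γ)) * θ ^ k) := by
    intro k
    calc ∫⁻ z in Ioc (2 ^ k * R) (2 ^ (k + 1) * R), ENNReal.ofReal z ∂lam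
        ≤ ∫⁻ _ in Ioc (2 ^ k * R) (2 ^ (k + 1) * R), ENNReal.ofReal (2 ^ (k + 1) * R) ∂lam :=
          setLIntegral_mono' measurableSet_Ioc fun z hz => ENNReal.ofReal_le_ofReal hz.2
      _ = ENNReal.ofReal (2 ^ (k + 1) * R) * lam (Ioc (2 ^ k * R) (2 ^ (k + 1) * R)) :=
          setLIntegral_const _ _
      _ ≤ ENNReal.ofReal (2 ^ (k + 1) * R) * lam (Ioi (2 ^ k * R)) := by
          gcongr
          exact Ioc_subset_Ioi_self
      _ ≤ _ := by
          rw [measure_Ioi_eq_ofReal hfin hrep (hR1.trans (hge k)),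
            ← ENNReal.ofReal_mul (by positivity)]
          refine ENNReal.ofReal_le_ofReal ?_
          calc 2 ^ (k + 1) * R * (ℓ (2 ^ k * R) * (2 ^ k * R) ^ (-γ))
              = 2 * R * (2 ^ k * (ℓ (2 ^ k * R) * (2 ^ k * R) ^ (-γ))) := by ring
            _ ≤ 2 * R * (θ ^ k * (ℓ R * R ^ (-γ))) :=
                mul_le_mul_of_nonneg_left (hgeom k) (by positivity)
            _ = _ := by ring
  calc ∫⁻ z in Ioi R, ENNReal.ofReal z ∂lam
      ≤ ∑' k : ℕ, ∫⁻ z in Ioc (2 ^ k * R) (2 ^ (k + 1) * R), ENNReal.ofReal z ∂lam :=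
        (lintegral_mono_set hcover).trans (lintegral_iUnion_le _ _)
    _ ≤ ∑' k : ℕ, ENNReal.ofReal (2 * R * (ℓ R * R ^ (-γ)) * θ ^ k) := ENNReal.tsum_le_tsum hpiece
    _ = ENNReal.ofReal (2 / (1 - θ) * (ℓ R * R ^ (1 - γ))) := by
        rw [← ENNReal.ofReal_tsum_of_nonneg (fun k => by positivity)
          ((summable_geometric_of_lt_one hθ0.le hθ1).mul_left _), tsum_mul_left,
          tsum_geometric_of_lt_one hθ0.le hθ1, sub_eq_add_neg 1 γ, Real.rpow_add hR0,
          Real.rpow_one]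
        congr 1
        ring

theorem integrableOn_div_self_Ioc (hγ : 0 < γ) (hfin : ∀ a > 0, lam (Ioi a) < ⊤)
    (hrep : ∀ r ≥ (1 : ℝ), (lam (Ioi r)).toReal = ℓ r * r ^ (-γ)) (hℓ : SlowlyVarying ℓ)
    (r : ℝ) : IntegrableOn (fun u => ℓ u / u) (Ioc 1 r) := by
  refine Measure.integrableOn_of_bounded (M := ℓ 1 * r ^ γ) measure_Ioc_lt_top.ne
    (hℓ.1.div measurable_id).aestronglyMeasurable
    ((ae_restrict_iff' measurableSet_Ioc).2 (Eventually.of_forall fun u hu => ?_))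
  have hu0 : 0 < u := by linarith [hu.1]
  have hℓu := hℓ.2.1 u hu.1.le
  have hℓ1 := hℓ.2.1 1 le_rfl
  have h := tail_antitone hfin hrep le_rfl hu.1.le
  rw [Real.one_rpow, mul_one, Real.rpow_neg hu0.le, ← div_eq_mul_inv,
    div_le_iff₀ (by positivity)] at h
  rw [Real.norm_of_nonneg (by positivity)]
  calc ℓ u / u ≤ ℓ u := div_le_self hℓu.le hu.1.le
    _ ≤ ℓ 1 * u ^ γ := h
    _ ≤ ℓ 1 * r ^ γ := by gcongr; exact hu.2

theorem setIntegral_div_self_add (hγ : 0 < γ) (hfin : ∀ a > 0, lam (Ioi a) < ⊤)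
    (hrep : ∀ r ≥ (1 : ℝ), (lam (Ioi r)).toReal = ℓ r * r ^ (-γ)) (hℓ : SlowlyVarying ℓ)
    {a b : ℝ} (ha : 1 ≤ a) (hab : a ≤ b) :
    ∫ u in Ioc 1 b, ℓ u / u = (∫ u in Ioc 1 a, ℓ u / u) + ∫ u in Ioc a b, ℓ u / u := by
  rw [← Ioc_union_Ioc_eq_Ioc ha hab]
  have hI := integrableOn_div_self_Ioc hγ hfin hrep hℓ
  exact setIntegral_union (Ioc_disjoint_Ioc_of_le le_rfl) measurableSet_Ioc (hI a)
    ((hI b).mono_set (Ioc_subset_Ioc_left ha))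

theorem setIntegral_div_self_le (hγ : 0 < γ) (hfin : ∀ a > 0, lam (Ioi a) < ⊤)
    (hrep : ∀ r ≥ (1 : ℝ), (lam (Ioi r)).toReal = ℓ r * r ^ (-γ)) (hℓ : SlowlyVarying ℓ)
    {a c : ℝ} (ha : 1 ≤ a) (hc : 1 ≤ c) :
    ∫ u in Ioc a (c * a), ℓ u / u ≤ (c - 1) * c ^ γ * ℓ a := by
  have ha0 : 0 < a := by linarith
  have hca : a ≤ c * a := le_mul_of_one_le_left ha0.le hc
  have hℓa := hℓ.2.1 a ha
  have hpt : ∀ u ∈ Ioc a (c * a), ℓ u / u ≤ c ^ γ * ℓ a / a := by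
    intro u hu
    have hu0 : 0 < u := ha0.trans hu.1
    have h := tail_antitone hfin hrep ha hu.1.le
    rw [Real.rpow_neg hu0.le, ← div_eq_mul_inv, div_le_iff₀ (by positivity)] at h
    have h2 : ℓ u ≤ c ^ γ * ℓ a := by
      calc ℓ u ≤ ℓ a * a ^ (-γ) * u ^ γ := h
        _ ≤ ℓ a * a ^ (-γ) * (c * a) ^ γ := by gcongr; exact hu.2
        _ = c ^ γ * ℓ a := by
          rw [Real.mul_rpow (by linarith) ha0.le, Real.rpow_neg ha0.le]
          field_simp
    exact div_le_div₀ (by positivity) h2 ha0 hu.1.le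
  have hmono := setIntegral_mono_on ((integrableOn_div_self_Ioc hγ hfin hrep hℓ (c * a)).mono_set
    (Ioc_subset_Ioc_left ha)) (integrableOn_const measure_Ioc_lt_top.ne) measurableSet_Ioc hpt
  refine hmono.trans_eq ?_
  rw [setIntegral_const, Real.volume_real_Ioc_of_le hca, smul_eq_mul]
  field_simp

theorem le_setIntegral_div_self (hγ : 0 < γ) (hfin : ∀ a > 0, lam (Ioi a) < ⊤)
    (hrep : ∀ r ≥ (1 : ℝ), (lam (Ioi r)).toReal = ℓ r * r ^ (-γ)) (hℓ : SlowlyVarying ℓ)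
    {a : ℝ} (ha : 1 ≤ a) :
    2 ^ (-γ) / 2 * ℓ (2 * a) ≤ ∫ u in Ioc a (2 * a), ℓ u / u := by
  have ha0 : 0 < a := by linarith
  have hℓa := hℓ.2.1 (2 * a) (by linarith)
  have hpt : ∀ u ∈ Ioc a (2 * a), 2 ^ (-γ) * ℓ (2 * a) / (2 * a) ≤ ℓ u / u := by
    intro u hu
    have hu0 : 0 < u := ha0.trans hu.1
    have h := tail_antitone hfin hrep (ha.trans hu.1.le) hu.2
    rw [Real.rpow_neg hu0.le, ← div_eq_mul_inv (ℓ u), le_div_iff₀ (by positivity)] at h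
    have h2 : 2 ^ (-γ) * ℓ (2 * a) ≤ ℓ u := by
      calc 2 ^ (-γ) * ℓ (2 * a) = ℓ (2 * a) * (2 * a) ^ (-γ) * a ^ γ := by
            rw [Real.mul_rpow (by norm_num) ha0.le, Real.rpow_neg ha0.le]
            field_simp
        _ ≤ ℓ (2 * a) * (2 * a) ^ (-γ) * u ^ γ := by gcongr; exact hu.1.le
        _ ≤ ℓ u := h
    exact div_le_div₀ (by linarith [hℓ.2.1 u (ha.trans hu.1.le)]) h2 hu0 hu.2
  have hmono := setIntegral_mono_on (integrableOn_const measure_Ioc_lt_top.ne)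
    ((integrableOn_div_self_Ioc hγ hfin hrep hℓ (2 * a)).mono_set
    (Ioc_subset_Ioc_left ha)) measurableSet_Ioc hpt
  refine le_of_eq_of_le ?_ hmono
  rw [setIntegral_const, Real.volume_real_Ioc_of_le (by linarith), smul_eq_mul]
  field_simp
  ring

/-- A slowly varying function is negligible against its logarithmic integral. -/
theorem tendsto_div_setIntegral_div_self (hγ : 0 < γ) (hfin : ∀ a > 0, lam (Ioi a) < ⊤)
    (hrep : ∀ r ≥ (1 : ℝ), (lam (Ioi r)).toReal = ℓ r * r ^ (-γ)) (hℓ : SlowlyVarying ℓ) :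
    Tendsto (fun r => ℓ r / ∫ u in Ioc 1 r, ℓ u / u) atTop (𝓝 0) := by
  have hc : (0 : ℝ) < 2 ^ (-γ) / 2 := by positivity
  have key : ∀ N : ℕ, ∀ᶠ r in atTop,
      N * (2 ^ (-γ) / 2 / 2) * ℓ r ≤ ∫ u in Ioc 1 r, ℓ u / u := by
    intro N
    induction N with
    | zero =>
      refine Eventually.of_forall fun r => ?_
      simp only [CharP.cast_eq_zero, zero_mul]
      refine setIntegral_nonneg measurableSet_Ioc fun u hu => ?_
      have := hℓ.2.1 u hu.1.le
      have := hu.1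
      positivity
    | succ N ih =>
      have hhalf : Tendsto (fun r : ℝ => 1 / 2 * r) atTop atTop :=
        tendsto_id.const_mul_atTop (by norm_num)
      have hlt : (1 - 1 / ((N : ℝ) + 1)) < 1 := by
        have : (0 : ℝ) < 1 / ((N : ℝ) + 1) := by positivity
        linarith
      filter_upwards [hhalf.eventually ih, (hℓ.2.2 (1 / 2) (by norm_num)).eventually
        (eventually_gt_nhds hlt), eventually_ge_atTop 2] with r h1 h2 h3
      have hℓr := hℓ.2.1 r (by linarith)
      rw [lt_div_iff₀ hℓr] at h2
      have h4 := setIntegral_div_self_add hγ hfin hrep hℓ (a := 1 / 2 * r) (b := r)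
        (by linarith) (by linarith)
      have h5 := le_setIntegral_div_self hγ hfin hrep hℓ (a := 1 / 2 * r) (by linarith)
      rw [show 2 * (1 / 2 * r) = r by ring] at h5
      have h6 : ((N : ℝ) - 1) * ℓ r ≤ N * ℓ (1 / 2 * r) := by
        calc ((N : ℝ) - 1) * ℓ r ≤ N * (1 - 1 / ((N : ℝ) + 1)) * ℓ r := by
              gcongr
              have : (N : ℝ) * (1 / ((N : ℝ) + 1)) ≤ 1 := by
                rw [mul_one_div, div_le_one (by positivity)]
                linarith
              linarith
          _ = N * ((1 - 1 / ((N : ℝ) + 1)) * ℓ r) := by ring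
          _ ≤ _ := by gcongr
      have h7 := mul_le_mul_of_nonneg_left h6 (show (0 : ℝ) ≤ 2 ^ (-γ) / 2 / 2 by positivity)
      push_cast
      nlinarith
  refine (nhds_basis_zero_abs_lt ℝ).tendsto_right_iff.2 fun ε hε => ?_
  obtain ⟨N, hN⟩ := exists_nat_gt (1 / (ε * (2 ^ (-γ) / 2 / 2)))
  filter_upwards [key N, eventually_ge_atTop 1] with r h1 h2
  have hℓr := hℓ.2.1 r h2
  have hN' : 1 < N * (2 ^ (-γ) / 2 / 2) * ε := by
    rw [div_lt_iff₀ (by positivity)] at hN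
    linarith
  have hNpos : 0 < N * ((2 : ℝ) ^ (-γ) / 2 / 2) := by
    by_contra hcon
    nlinarith [mul_nonneg_of_nonpos_of_nonpos (not_lt.1 hcon) (neg_nonpos.2 hε.le)]
  have hL : 0 < ∫ u in Ioc 1 r, ℓ u / u := lt_of_lt_of_le (mul_pos hNpos hℓr) h1
  rw [abs_of_pos (div_pos hℓr hL), div_lt_iff₀ hL]
  calc ℓ r < N * (2 ^ (-γ) / 2 / 2) * ε * ℓ r := lt_mul_of_one_lt_left hℓr hN'
    _ = ε * (N * (2 ^ (-γ) / 2 / 2) * ℓ r) := by ring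
    _ ≤ _ := by gcongr

/-- The logarithmic integral of a slowly varying function is slowly varying. -/
theorem tendsto_setIntegral_div_self_mul (hγ : 0 < γ) (hfin : ∀ a > 0, lam (Ioi a) < ⊤)
    (hrep : ∀ r ≥ (1 : ℝ), (lam (Ioi r)).toReal = ℓ r * r ^ (-γ)) (hℓ : SlowlyVarying ℓ)
    (hdiv : Tendsto (fun r : ℝ => ∫ u in Ioc (1 : ℝ) r, ℓ u / u) atTop atTop) {c : ℝ}
    (hc : 0 < c) :
    Tendsto (fun r => (∫ u in Ioc 1 (c * r), ℓ u / u) / ∫ u in Ioc 1 r, ℓ u / u) atTop (𝓝 1) := by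
  have hbig : ∀ c : ℝ, 1 ≤ c →
      Tendsto (fun r => (∫ u in Ioc 1 (c * r), ℓ u / u) / ∫ u in Ioc 1 r, ℓ u / u)
        atTop (𝓝 1) := by
    intro c hc
    have hup : Tendsto (fun r => 1 + (c - 1) * c ^ γ * (ℓ r / ∫ u in Ioc 1 r, ℓ u / u)) atTop
        (𝓝 1) := by
      simpa using ((tendsto_div_setIntegral_div_self hγ hfin hrep hℓ).const_mul
        ((c - 1) * c ^ γ)).const_add 1
    refine tendsto_of_tendsto_of_tendsto_of_le_of_le' tendsto_const_nhds hup ?_ ?_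
    all_goals
      filter_upwards [eventually_ge_atTop 1, hdiv.eventually_gt_atTop 0] with r hr hL
      have hcr : r ≤ c * r := le_mul_of_one_le_left (by linarith) hc
      have hadd := setIntegral_div_self_add hγ hfin hrep hℓ hr hcr
      have hle := setIntegral_div_self_le hγ hfin hrep hℓ hr hc
      have hnn : 0 ≤ ∫ u in Ioc r (c * r), ℓ u / u := by
        refine setIntegral_nonneg measurableSet_Ioc fun u hu => ?_
        have := hℓ.2.1 u (hr.trans hu.1.le)
        have := hr.trans hu.1.le
        positivity
      rw [hadd]
    · rw [one_le_div hL]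
      linarith
    · rw [div_le_iff₀ hL, add_mul, one_mul, mul_assoc, div_mul_cancel₀ _ hL.ne']
      linarith
  rcases le_or_gt 1 c with h | h
  · exact hbig c h
  · have h1 := (hbig c⁻¹ ((one_le_inv₀ hc).2 h.le)).comp (tendsto_id.const_mul_atTop hc)
    have h2 := h1.inv₀ one_ne_zero
    rw [inv_one] at h2
    refine h2.congr fun r => ?_
    simp [inv_mul_cancel_left₀ hc.ne']

/-- Truncated `γ`-moment of a measure with regularly varying tail of the same index `-γ`. -/
theorem lintegral_Ioc_rpow_eq (hγ : 0 < γ) (hfin : ∀ a > 0, lam (Ioi a) < ⊤)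
    (hrep : ∀ r ≥ (1 : ℝ), (lam (Ioi r)).toReal = ℓ r * r ^ (-γ)) (hℓ : SlowlyVarying ℓ)
    {x : ℝ} (hx : 1 ≤ x) :
    ∫⁻ z in Ioc 1 x, ENNReal.ofReal (z ^ γ) ∂lam =
      ENNReal.ofReal (γ * (∫ u in Ioc 1 x, ℓ u / u) + ℓ 1 - ℓ x) := by
  have hx0 : 0 < x := by linarith
  have hnn : 0 ≤ᵐ[lam.restrict (Ioc 1 x)] (fun z : ℝ => z) :=
    (ae_restrict_iff' measurableSet_Ioc).2
      (Eventually.of_forall fun u hu => zero_le_one.trans hu.1.le)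
  rw [lintegral_rpow_eq_lintegral_meas_lt_mul _ hnn aemeasurable_id hγ]
  have hμ : ∀ u : ℝ, (lam.restrict (Ioc 1 x)) {a | u < a} = lam (Ioc (max u 1) x) := by
    intro u
    rw [Measure.restrict_apply (measurableSet_lt measurable_const measurable_id')]
    congr 1
    ext a
    simp only [mem_inter_iff, mem_ofPred_eq, mem_Ioc, max_lt_iff]
    tauto
  simp_rw [hμ]
  set B := ℓ x * x ^ (-γ) with hB
  have hB0 : 0 ≤ B := mul_nonneg (hℓ.2.1 x hx).le (by positivity)
  have hB1 : B ≤ ℓ 1 := by simpa using tail_antitone hfin hrep le_rfl hx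
  have hpow : ∀ a b : ℝ, a ≤ b → ∫ u in Ioc a b, u ^ (γ - 1) = (b ^ γ - a ^ γ) / γ := by
    intro a b hab
    rw [← intervalIntegral.integral_of_le hab, integral_rpow (Or.inl (by linarith)),
      sub_add_cancel]
  have hpowint : ∀ a b : ℝ, a ≤ b → IntegrableOn (fun u : ℝ => u ^ (γ - 1)) (Ioc a b) :=
    fun a b hab => (intervalIntegrable_iff_integrableOn_Ioc_of_le hab).1
      (intervalIntegral.intervalIntegrable_rpow' (by linarith))
  have h1 : ∫⁻ u in Ioc 0 1, lam (Ioc (max u 1) x) * ENNReal.ofReal (u ^ (γ - 1)) =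
      ENNReal.ofReal ((ℓ 1 - B) / γ) := by
    have hpt : ∀ u ∈ Ioc (0 : ℝ) 1, lam (Ioc (max u 1) x) * ENNReal.ofReal (u ^ (γ - 1)) =
        ENNReal.ofReal (ℓ 1 - B) * ENNReal.ofReal (u ^ (γ - 1)) := by
      intro u hu
      rw [max_eq_right hu.2, measure_Ioc_eq_ofReal hfin hrep hℓ le_rfl hx, Real.one_rpow, mul_one]
    rw [setLIntegral_congr_fun measurableSet_Ioc hpt,
      lintegral_const_mul' _ _ ENNReal.ofReal_ne_top,
      ← ofReal_integral_eq_lintegral_ofReal (hpowint 0 1 zero_le_one), hpow 0 1 zero_le_one,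
      ← ENNReal.ofReal_mul (by linarith), Real.one_rpow, Real.zero_rpow hγ.ne']
    · congr 1
      ring
    · refine (ae_restrict_iff' measurableSet_Ioc).2 (Eventually.of_forall fun u hu => ?_)
      have := hu.1
      simp only [Pi.zero_apply]
      positivity
  have hdom : ∀ u ∈ Ioc 1 x, 0 ≤ ℓ u / u - B * u ^ (γ - 1) ∧
      ℓ u / u - B * u ^ (γ - 1) = (ℓ u * u ^ (-γ) - B) * u ^ (γ - 1) := by
    intro u hu
    have hu0 : 0 < u := by linarith [hu.1]
    have e : ℓ u / u - B * u ^ (γ - 1) = (ℓ u * u ^ (-γ) - B) * u ^ (γ - 1) := by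
      rw [sub_mul, mul_assoc (ℓ u), ← Real.rpow_add hu0, show -γ + (γ - 1) = -1 by ring,
        Real.rpow_neg_one, div_eq_mul_inv]
    refine ⟨?_, e⟩
    rw [e]
    exact mul_nonneg (sub_nonneg.2 (tail_antitone hfin hrep hu.1.le hu.2)) (by positivity)
  have hint := integrableOn_div_self_Ioc hγ hfin hrep hℓ x
  have hint' : IntegrableOn (fun u => B * u ^ (γ - 1)) (Ioc 1 x) := (hpowint 1 x hx).const_mul B
  have hval : ∫ u in Ioc 1 x, (ℓ u / u - B * u ^ (γ - 1)) =
      (∫ u in Ioc 1 x, ℓ u / u) - B * ((x ^ γ - 1) / γ) := by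
    rw [integral_sub hint hint', integral_const_mul, hpow 1 x hx, Real.one_rpow]
  have h2 : ∫⁻ u in Ioc 1 x, lam (Ioc (max u 1) x) * ENNReal.ofReal (u ^ (γ - 1)) =
      ENNReal.ofReal ((∫ u in Ioc 1 x, ℓ u / u) - B * ((x ^ γ - 1) / γ)) := by
    have hpt : ∀ u ∈ Ioc 1 x, lam (Ioc (max u 1) x) * ENNReal.ofReal (u ^ (γ - 1)) =
        ENNReal.ofReal (ℓ u / u - B * u ^ (γ - 1)) := by
      intro u hu
      rw [max_eq_left hu.1.le, measure_Ioc_eq_ofReal hfin hrep hℓ hu.1.le hu.2, (hdom u hu).2,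
        ENNReal.ofReal_mul (sub_nonneg.2 (tail_antitone hfin hrep hu.1.le hu.2))]
    rw [setLIntegral_congr_fun measurableSet_Ioc hpt, ← hval,
      ← ofReal_integral_eq_lintegral_ofReal (f := fun u => ℓ u / u - B * u ^ (γ - 1))
        (hint.sub hint')]
    exact (ae_restrict_iff' measurableSet_Ioc).2 (Eventually.of_forall fun u hu => (hdom u hu).1)
  have h3 : ∫⁻ u in Ioi x, lam (Ioc (max u 1) x) * ENNReal.ofReal (u ^ (γ - 1)) = 0 := by
    rw [setLIntegral_congr_fun (g := fun _ => 0) measurableSet_Ioi, lintegral_zero]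
    intro u hu
    have hu' : x < u := hu
    simp only
    rw [Ioc_eq_empty (not_lt.2 (hu'.le.trans (le_max_left _ _))), measure_empty, zero_mul]
  rw [← Ioc_union_Ioi_eq_Ioi zero_le_one, lintegral_union measurableSet_Ioi
    (Ioc_disjoint_Ioi le_rfl), ← Ioc_union_Ioi_eq_Ioi hx, lintegral_union measurableSet_Ioi
    (Ioc_disjoint_Ioi le_rfl), h1, h2, h3, add_zero,
    ← ENNReal.ofReal_add (div_nonneg (by linarith) hγ.le), ← ENNReal.ofReal_mul hγ.le]
  · congr 1
    have hBx : B * x ^ γ = ℓ x := by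
      rw [hB, Real.rpow_neg hx0.le]
      field_simp
    rw [← hBx]
    field_simp
    ring
  · rw [← hval]
    exact setIntegral_nonneg measurableSet_Ioc fun u hu => (hdom u hu).1

end SlowlyVaryingTail

/-- Condition (E) makes the truncated moment of order `1 + 2/d` finite. -/
theorem Mgamma_one_lt_top {d : ℕ} (hd : 1 ≤ d) {lam : Measure ℝ} (hlam : IsLevyMeasure lam)
    (hE : ConditionE d lam) : Mgamma lam (1 + 2 / (d : ℝ)) 1 < ⊤ := by
  rcases lt_or_ge d 3 with h3 | h3
  · have hd0 : (0 : ℝ) < d := by exact_mod_cast hd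
    have h2 : (2 : ℝ) ≤ 1 + 2 / (d : ℝ) := by
      have : (d : ℝ) ≤ 2 := by exact_mod_cast Nat.lt_succ_iff.1 h3
      have := (one_le_div hd0).2 this
      linarith
    refine lt_of_le_of_lt ?_ hlam.2.2
    refine (setLIntegral_mono' measurableSet_Ioc fun z hz => ENNReal.ofReal_le_ofReal ?_).trans
      (lintegral_mono_set Ioc_subset_Ioi_self)
    have hle : z ^ (1 + 2 / (d : ℝ)) ≤ z ^ 2 := by
      rw [← Real.rpow_two]
      exact Real.rpow_le_rpow_of_exponent_ge hz.1 hz.2 h2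
    exact le_min (hle.trans (pow_le_one₀ hz.1.le hz.2)) hle
  · exact hE.2.2.2 h3

theorem Mgamma_eq {lam : Measure ℝ} {γ : ℝ} {ℓ : ℝ → ℝ} (hγ : 0 < γ)
    (hfin : ∀ a > 0, lam (Ioi a) < ⊤)
    (hrep : ∀ r ≥ (1 : ℝ), (lam (Ioi r)).toReal = ℓ r * r ^ (-γ)) (hℓ : SlowlyVarying ℓ)
    {x : ℝ} (hx : 1 ≤ x) :
    Mgamma lam γ x = Mgamma lam γ 1 +
      ENNReal.ofReal (γ * (∫ u in Ioc 1 x, ℓ u / u) + ℓ 1 - ℓ x) := by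
  rw [← lintegral_Ioc_rpow_eq hγ hfin hrep hℓ hx, Mgamma, Mgamma,
    ← Ioc_union_Ioc_eq_Ioc zero_le_one hx,
    lintegral_union measurableSet_Ioc (Ioc_disjoint_Ioc_of_le le_rfl)]

/-- The truncated moment is asymptotic to `γ` times the logarithmic integral. -/
theorem tendsto_Mgamma_div {lam : Measure ℝ} {γ : ℝ} {ℓ : ℝ → ℝ} (hγ : 0 < γ)
    (hfin : ∀ a > 0, lam (Ioi a) < ⊤)
    (hrep : ∀ r ≥ (1 : ℝ), (lam (Ioi r)).toReal = ℓ r * r ^ (-γ)) (hℓ : SlowlyVarying ℓ)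
    (hM : Mgamma lam γ 1 < ⊤)
    (hdiv : Tendsto (fun r : ℝ => ∫ u in Ioc (1 : ℝ) r, ℓ u / u) atTop atTop) :
    Tendsto (fun x => (Mgamma lam γ x).toReal / ∫ u in Ioc 1 x, ℓ u / u) atTop (𝓝 γ) := by
  have hsmall := tendsto_div_setIntegral_div_self hγ hfin hrep hℓ
  have hlim : Tendsto (fun x => ((Mgamma lam γ 1).toReal + ℓ 1) / (∫ u in Ioc 1 x, ℓ u / u) + γ -
      ℓ x / ∫ u in Ioc 1 x, ℓ u / u) atTop (𝓝 γ) := by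
    simpa using ((tendsto_const_nhds.div_atTop hdiv).add_const γ).sub hsmall
  refine hlim.congr' ?_
  filter_upwards [eventually_ge_atTop 1, hdiv.eventually_gt_atTop 0,
    hsmall.eventually (eventually_lt_nhds hγ)] with x hx hL hlt
  rw [div_lt_iff₀ hL] at hlt
  have hℓ1 := hℓ.2.1 1 le_rfl
  rw [Mgamma_eq hγ hfin hrep hℓ hx, ENNReal.toReal_add hM.ne ENNReal.ofReal_ne_top,
    ENNReal.toReal_ofReal (by linarith)]
  field_simp
  ring

/-- `η̄(r)` is, up to an error of the order of the tail of `λ`, a multiple of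
`r^{-γ} M_γ(x₀ r)` with `γ = 1 + 2/d`. -/
theorem exists_etaBar_eq {d : ℕ} (hd : 1 ≤ d) {κ t : ℝ} (hκ : 0 < κ) (ht : 0 < t)
    {lam : Measure ℝ} (hlam : IsLevyMeasure lam) {ℓ : ℝ → ℝ} (hℓ : SlowlyVarying ℓ)
    (hrep : ∀ r ≥ (1 : ℝ), (lam (Ioi r)).toReal = ℓ r * r ^ (-(1 + 2 / (d : ℝ)))) :
    ∃ x₀ > 0, ∃ K : ℝ, 0 ≤ K ∧ ∀ᶠ r in atTop, ∃ T : ℝ≥0∞,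
      etaBar d κ t lam r = ENNReal.ofReal
        (((d : ℝ) * π * κ * (1 + 2 / (d : ℝ)) ^ ((d : ℝ) / 2))⁻¹ / (1 + 2 / (d : ℝ)) *
          r ^ (-(1 + 2 / (d : ℝ)))) * Mgamma lam (1 + 2 / (d : ℝ)) (x₀ * r) + T ∧
      T ≤ ENNReal.ofReal (K * ℓ (x₀ * r) * r ^ (-(1 + 2 / (d : ℝ)))) := by
  have hd0 : (0 : ℝ) < d := by exact_mod_cast hd
  have hpi := Real.pi_pos
  have := hlam.sigmaFinite
  have hV := unitBallVolume_pos d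
  set γ := 1 + 2 / (d : ℝ) with hγdef
  have hγ : 1 < γ := by
    have : 0 < 2 / (d : ℝ) := by positivity
    linarith
  set C := ((d : ℝ) * π * κ * γ ^ ((d : ℝ) / 2))⁻¹ / γ with hC
  have hC0 : 0 < C := by positivity
  obtain ⟨K, hK0, hK⟩ := exists_lintegral_Ioi_le hγ (fun a ha => hlam.measure_Ioi_lt_top ha)
    hrep hℓ
  set x₀ := (2 * π * κ * t) ^ ((d : ℝ) / 2) with hx₀
  have hx₀0 : 0 < x₀ := by positivity
  set K₁ := unitBallVolume d * ((d : ℝ) * κ / (2 * π * κ)) ^ ((d : ℝ) / 2) * t with hK₁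
  have hK₁0 : 0 < K₁ := by positivity
  refine ⟨x₀, hx₀0, K₁ * K * x₀ ^ (1 - γ), by positivity, ?_⟩
  filter_upwards [(tendsto_id.const_mul_atTop hx₀0).eventually hK, eventually_gt_atTop 0]
    with r hKr hr
  simp only [id] at hKr
  refine ⟨∫⁻ z in Ioi (x₀ * r), etaSlice d κ t r z ∂lam, ?_, ?_⟩
  · rw [etaBar_eq_lintegral_etaSlice, ← Ioc_union_Ioi_eq_Ioi (by positivity : 0 ≤ x₀ * r),
      lintegral_union measurableSet_Ioi (Ioc_disjoint_Ioi le_rfl), Mgamma,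
      ← lintegral_const_mul' _ _ ENNReal.ofReal_ne_top]
    congr 1
    refine setLIntegral_congr_fun measurableSet_Ioc fun z hz => ?_
    have hz0 := hz.1
    have hw : (z / r) ^ (2 / (d : ℝ)) / (2 * π * κ) ≤ t := by
      rw [div_le_iff₀ (by positivity)]
      calc (z / r) ^ (2 / (d : ℝ)) ≤ x₀ ^ (2 / (d : ℝ)) :=
            Real.rpow_le_rpow (by positivity) ((div_le_iff₀ hr).2 hz.2) (by positivity)
        _ = t * (2 * π * κ) := by
            rw [hx₀, ← Real.rpow_mul (by positivity),
              show (d : ℝ) / 2 * (2 / d) = 1 by field_simp, Real.rpow_one]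
            ring
    rw [etaSlice_eq hd hκ hr hz0 hw, ← ENNReal.ofReal_mul (by positivity)]
    congr 1
    rw [Real.div_rpow hz0.le hr.le, Real.rpow_neg hr.le]
    ring
  · calc ∫⁻ z in Ioi (x₀ * r), etaSlice d κ t r z ∂lam
        ≤ ∫⁻ z in Ioi (x₀ * r), ENNReal.ofReal (K₁ / r) * ENNReal.ofReal z ∂lam :=
          setLIntegral_mono' measurableSet_Ioi fun z hz =>
            etaSlice_le hd hκ ht hr ((by positivity : 0 < x₀ * r).trans hz)
      _ = ENNReal.ofReal (K₁ / r) * ∫⁻ z in Ioi (x₀ * r), ENNReal.ofReal z ∂lam :=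
          lintegral_const_mul' _ _ ENNReal.ofReal_ne_top
      _ ≤ ENNReal.ofReal (K₁ / r) * ENNReal.ofReal (K * (ℓ (x₀ * r) * (x₀ * r) ^ (1 - γ))) := by
          gcongr
      _ = _ := by
          rw [← ENNReal.ofReal_mul (by positivity)]
          congr 1
          rw [Real.mul_rpow hx₀0.le hr.le, sub_eq_add_neg 1 γ, Real.rpow_add hr, Real.rpow_one]
          field_simp

/-- Lemma 2.2 (ii), case `α = 1 + 2/d`: if `λ̄(r) = ℓ(r) r^{-(1+2/d)}` with `ℓ`
slowly varying and `∫_1^∞ ℓ(u)/u du = ∞`, then with `L(r) = ∫_1^r ℓ(u)/u du`,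
`η̄(r) ~ L(r) r^{-1-2/d} / (dπκ(1+2/d)^{d/2})` as `r → ∞`. -/
theorem stmt_5 (d : ℕ) (hd : 1 ≤ d) (κ t : ℝ) (hκ : 0 < κ) (ht : 0 < t)
    (lam : Measure ℝ) (hlam : IsLevyMeasure lam) (hE : ConditionE d lam)
    (ℓ : ℝ → ℝ) (hℓ : SlowlyVarying ℓ)
    (hrep : ∀ r ≥ (1 : ℝ), (lam (Set.Ioi r)).toReal = ℓ r * r ^ (-(1 + 2 / (d : ℝ))))
    (hdiv : Tendsto (fun r : ℝ => ∫ u in Set.Ioc (1 : ℝ) r, ℓ u / u) atTop atTop)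
    (L : ℝ → ℝ) (hL : ∀ r : ℝ, L r = ∫ u in Set.Ioc (1 : ℝ) r, ℓ u / u) :
    Tendsto (fun r : ℝ =>
        (etaBar d κ t lam r).toReal /
          (L r * r ^ (-(1 + 2 / (d : ℝ))) /
            ((d : ℝ) * π * κ * (1 + 2 / (d : ℝ)) ^ ((d : ℝ) / 2))))
      atTop (𝓝 1) := by
  have hd0 : (0 : ℝ) < d := by exact_mod_cast hd
  have hpi := Real.pi_pos
  have hM := Mgamma_one_lt_top hd hlam hE
  obtain ⟨x₀, hx₀, K, hK0, hev⟩ := exists_etaBar_eq hd hκ ht hlam hℓ hrep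
  have hfin : ∀ a > 0, lam (Ioi a) < ⊤ := fun a ha => hlam.measure_Ioi_lt_top ha
  have hγ : 0 < 1 + 2 / (d : ℝ) := by positivity
  set γ := 1 + 2 / (d : ℝ) with hγdef
  set C := (d : ℝ) * π * κ * γ ^ ((d : ℝ) / 2) with hC
  have hC0 : 0 < C := by positivity
  obtain rfl : L = fun r => ∫ u in Ioc (1 : ℝ) r, ℓ u / u := funext hL
  have hscale : Tendsto (fun r : ℝ => x₀ * r) atTop atTop := tendsto_id.const_mul_atTop hx₀
  have hratio := tendsto_setIntegral_div_self_mul hγ hfin hrep hℓ hdiv hx₀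
  have hMlim : Tendsto (fun r => (Mgamma lam γ (x₀ * r)).toReal / (∫ u in Ioc 1 r, ℓ u / u) / γ)
      atTop (𝓝 1) := by
    have h := (((tendsto_Mgamma_div hγ hfin hrep hℓ hM hdiv).comp hscale).mul hratio).div_const γ
    rw [mul_one, div_self hγ.ne'] at h
    refine h.congr' ?_
    filter_upwards [hscale.eventually (hdiv.eventually_gt_atTop 0)] with r h1
    simp only [Function.comp_apply]
    rw [div_mul_div_cancel₀ h1.ne']
  have hℓlim : Tendsto (fun r => C * K * (ℓ (x₀ * r) / ∫ u in Ioc 1 r, ℓ u / u)) atTop (𝓝 0) := by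
    have h := (((tendsto_div_setIntegral_div_self hγ hfin hrep hℓ).comp hscale).mul
      hratio).const_mul (C * K)
    rw [zero_mul, mul_zero] at h
    refine h.congr' ?_
    filter_upwards [hscale.eventually (hdiv.eventually_gt_atTop 0)] with r h1
    simp only [Function.comp_apply]
    rw [div_mul_div_cancel₀ h1.ne']
  have hup := hMlim.add hℓlim
  rw [add_zero] at hup
  refine tendsto_of_tendsto_of_tendsto_of_le_of_le' hMlim hup ?_ ?_
  all_goals
    filter_upwards [hev, hscale.eventually_ge_atTop 1, hdiv.eventually_gt_atTop 0,
      eventually_gt_atTop 0] with r ⟨T, hT, hTle⟩ hx hLr hr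
    have hr' : 0 < r ^ (-γ) := by positivity
    have hTtop : T ≠ ⊤ := ne_top_of_le_ne_top ENNReal.ofReal_ne_top hTle
    have hMtop : Mgamma lam γ (x₀ * r) ≠ ⊤ := by
      rw [Mgamma_eq hγ hfin hrep hℓ hx]
      exact ENNReal.add_ne_top.2 ⟨hM.ne, ENNReal.ofReal_ne_top⟩
    have hℓx := hℓ.2.1 _ hx
    have hTreal : T.toReal ≤ K * ℓ (x₀ * r) * r ^ (-γ) :=
      ENNReal.toReal_le_of_le_ofReal (by positivity) hTle
    have hTnn : 0 ≤ T.toReal := ENNReal.toReal_nonneg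
    rw [hT, ENNReal.toReal_add (ENNReal.mul_ne_top ENNReal.ofReal_ne_top hMtop) hTtop,
      ENNReal.toReal_mul, ENNReal.toReal_ofReal (by positivity)]
    set I := ∫ u in Ioc 1 r, ℓ u / u
    set M := (Mgamma lam γ (x₀ * r)).toReal
    have e : (C⁻¹ / γ * r ^ (-γ) * M + T.toReal) / (I * r ^ (-γ) / C) =
        M / I / γ + C * T.toReal / (I * r ^ (-γ)) := by
      field_simp
    rw [e]
  · have : 0 ≤ C * T.toReal / (I * r ^ (-γ)) := by positivity
    linarith
  · gcongr
    rw [div_le_iff₀ (by positivity)]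
    calc C * T.toReal ≤ C * (K * ℓ (x₀ * r) * r ^ (-γ)) := by gcongr
      _ = _ := by field_simp
end
end

section
/- Let λ be a Lévy measure on (0,∞) satisfying Condition (E). Then 0 < η̄(x) < ∞ for all x > 0, and for every c > 1, c^{−(1+2/d)} ≤ liminf_{x→∞} η̄(cx)/η̄(x) ≤ limsup_{x→∞} η̄(cx)/η̄(x) ≤ 1. In particular η̄ has extended regular variation at infinity. -/
open MeasureTheory Real Filter Set
open scoped ENNReal Topology

noncomputable section

variable {d : ℕ} {κ t : ℝ} {lam : Measure ℝ}

lemma heatKernel_scaling (hκ : 0 < κ) {a s : ℝ} (ha : 0 < a) (hs : 0 < s)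
    (y : EuclideanSpace ℝ (Fin d)) :
    heatKernel d κ (a * s) (√a • y) = a ^ (-(d : ℝ) / 2) * heatKernel d κ s y := by
  unfold heatKernel
  have h1 : 2 * π * κ * (a * s) = a * (2 * π * κ * s) := by ring
  have h2 : -‖√a • y‖ ^ 2 / (2 * κ * (a * s)) = -‖y‖ ^ 2 / (2 * κ * s) := by
    rw [norm_smul, mul_pow, Real.norm_eq_abs, sq_abs, Real.sq_sqrt ha.le]
    field_simp
  rw [h1, h2, Real.mul_rpow ha.le (by positivity), mul_assoc]

lemma measurable_heatKernel :
    Measurable fun p : ℝ × EuclideanSpace ℝ (Fin d) => heatKernel d κ p.1 p.2 := by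
  unfold heatKernel
  fun_prop

/-- Logarithmic form of the superlevel-set condition for the heat kernel. -/
lemma pi_mul_norm_sq_lt (hκ : 0 < κ) {s u : ℝ} (hs : 0 < s) (hu : 0 < u)
    {y : EuclideanSpace ℝ (Fin d)} (h : u < heatKernel d κ s y) :
    π * ‖y‖ ^ 2 < 2 * π * κ * s * (-((d : ℝ) / 2) * log (2 * π * κ * s) - log u) := by
  have hw : 0 < 2 * π * κ * s := by positivity
  have h1 := Real.log_lt_log hu h
  unfold heatKernel at h1
  rw [Real.log_mul (by positivity) (by positivity), Real.log_rpow hw, Real.log_exp] at h1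
  have h2 : -‖y‖ ^ 2 / (2 * κ * s) = -(π * ‖y‖ ^ 2) / (2 * π * κ * s) := by field_simp
  rw [h2] at h1
  have h3 : π * ‖y‖ ^ 2 / (2 * π * κ * s) < -((d : ℝ) / 2) * log (2 * π * κ * s) - log u := by
    rw [neg_div (2 * π * κ * s)] at h1
    linarith
  rwa [div_lt_iff₀ hw, mul_comm _ (2 * π * κ * s)] at h3

lemma neg_mul_log_le_one {w : ℝ} (hw : 0 < w) : -(w * log w) ≤ 1 := by
  have h := Real.one_sub_inv_le_log_of_pos hw
  have h1 := mul_le_mul_of_nonneg_left h hw.le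
  rw [mul_sub, mul_inv_cancel₀ hw.ne'] at h1
  linarith

lemma bounds_of_lt_heatKernel (hd : 1 ≤ d) (hκ : 0 < κ) {s v : ℝ} (hs : 0 < s) (hv : 0 < v)
    {y : EuclideanSpace ℝ (Fin d)} (h : v ^ ((d : ℝ) / 2) < heatKernel d κ s y) :
    2 * π * κ * s ≤ v⁻¹ ∧ π * ‖y‖ ^ 2 ≤ d / 2 * v⁻¹ := by
  have hw : 0 < 2 * π * κ * s := by positivity
  have hd' : (0 : ℝ) < d := by exact_mod_cast hd
  have h1 := pi_mul_norm_sq_lt hκ hs (by positivity) h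
  rw [Real.log_rpow hv] at h1
  set w := 2 * π * κ * s
  have h2 : w * (-((d : ℝ) / 2) * log w - (d : ℝ) / 2 * log v)
      = (d : ℝ) / 2 * (v⁻¹ * -(w * v * log (w * v))) := by
    rw [Real.log_mul hw.ne' hv.ne']
    field_simp
    ring
  rw [h2] at h1
  have hwv : 0 < w * v := by positivity
  constructor
  · have h3 : 0 < (d : ℝ) / 2 * (v⁻¹ * -(w * v * log (w * v))) := lt_of_le_of_lt (by positivity) h1
    by_contra! hc
    have : 1 < w * v := by rwa [inv_lt_iff_one_lt_mul₀ hv] at hc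
    have h4 : 0 < log (w * v) := Real.log_pos this
    have : 0 < (d : ℝ) / 2 * (v⁻¹ * (w * v * log (w * v))) := by positivity
    linarith
  · refine h1.le.trans ?_
    gcongr
    exact mul_le_of_le_one_right (by positivity) (neg_mul_log_le_one hwv)

lemma norm_sq_bound_of_lt_heatKernel (hκ : 0 < κ) {s u : ℝ} (hs : 0 < s) (hst : s ≤ t)
    (hu : 0 < u) {y : EuclideanSpace ℝ (Fin d)} (h : u < heatKernel d κ s y) :
    π * ‖y‖ ^ 2 ≤ d / 2 + 2 * π * κ * t * |log u| := by
  have hw : 0 < 2 * π * κ * s := by positivity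
  have h1 := pi_mul_norm_sq_lt hκ hs hu h
  have h2 : 2 * π * κ * s * -log u ≤ 2 * π * κ * t * |log u| := by
    calc 2 * π * κ * s * -log u ≤ 2 * π * κ * s * |log u| := by
          gcongr
          exact neg_le_abs (log u)
      _ ≤ _ := by gcongr
  have h3 := mul_le_mul_of_nonneg_left (neg_mul_log_le_one hw) (show (0 : ℝ) ≤ d / 2 by positivity)
  nlinarith

/-- The `(s, y)`-section of the set measured by `etaBar`. -/
def heatSection (d : ℕ) (κ t r z : ℝ) : Set (ℝ × EuclideanSpace ℝ (Fin d)) :=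
  {p | p.1 ∈ Ioc (0 : ℝ) t ∧ r < heatKernel d κ p.1 p.2 * z}

lemma IsLevyMeasure.sFinite (h : IsLevyMeasure lam) : SFinite lam := by
  obtain ⟨-, h0, hfin⟩ := h
  have hres : lam.restrict (Ioi 0) = lam := by
    refine Measure.restrict_eq_self_of_ae_mem ?_
    rw [ae_iff]
    convert h0 using 2
    ext z
    simp
  set f : ℝ → ℝ≥0∞ := fun z => ENNReal.ofReal (min 1 (z ^ 2))
  have hf : Measurable f := by fun_prop
  have : IsFiniteMeasure ((lam.restrict (Ioi 0)).withDensity f) :=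
    isFiniteMeasure_withDensity hfin.ne
  rw [← hres, ← withDensity_inv_same (μ := lam.restrict (Ioi 0)) hf]
  · infer_instance
  · filter_upwards [ae_restrict_mem measurableSet_Ioi] with z hz
    have : 0 < z := hz
    simp only [f, ne_eq, ENNReal.ofReal_eq_zero, not_le]
    positivity
  · exact .of_forall fun z => ENNReal.ofReal_ne_top

lemma etaBar_eq_lintegral [SFinite lam] (r : ℝ) :
    etaBar d κ t lam r = ∫⁻ z in Ioi 0, volume (heatSection d κ t r z) ∂lam := by
  have hK := measurable_heatKernel (d := d) (κ := κ)
  set A : Set ((ℝ × EuclideanSpace ℝ (Fin d)) × ℝ) :=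
    {q | q.1.1 ∈ Ioc (0 : ℝ) t ∧ q.2 ∈ Ioi (0 : ℝ) ∧ r < heatKernel d κ q.1.1 q.1.2 * q.2} with hA
  have hAm : MeasurableSet A := by
    have hlt : MeasurableSet {q : (ℝ × EuclideanSpace ℝ (Fin d)) × ℝ |
        r < heatKernel d κ q.1.1 q.1.2 * q.2} :=
      measurableSet_lt measurable_const ((hK.comp measurable_fst).mul measurable_snd)
    exact (measurableSet_Ioc.preimage (measurable_fst.comp measurable_fst)).inter
      ((measurableSet_Ioi.preimage measurable_snd).inter hlt)
  have hmp := measurePreserving_prodAssoc (volume : Measure ℝ)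
    (volume : Measure (EuclideanSpace ℝ (Fin d))) lam
  have h1 : etaBar d κ t lam r = (volume.prod lam) A := by
    unfold etaBar
    rw [← hmp.measure_preimage_equiv]
    rfl
  rw [h1, Measure.prod_apply_symm hAm, ← lintegral_indicator measurableSet_Ioi]
  refine lintegral_congr fun z => ?_
  by_cases hz : 0 < z
  · simp [hA, heatSection, hz, preimage]
  · simp [hA, hz, preimage]

lemma etaBar_anti : Antitone (etaBar d κ t lam) := by
  intro r r' h
  exact measure_mono fun p hp => ⟨hp.1, hp.2.1, h.trans_lt hp.2.2⟩

lemma etaBar_le_mul [SFinite lam] (hd : 1 ≤ d) (hκ : 0 < κ) {c x : ℝ} (hc : 1 < c) :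
    etaBar d κ t lam x ≤
      ENNReal.ofReal (c ^ (1 + 2 / (d : ℝ))) * etaBar d κ t lam (c * x) := by
  have hd' : (0 : ℝ) < d := by exact_mod_cast hd
  have hc0 : 0 < c := by linarith
  set a : ℝ := c ^ (-(2 / (d : ℝ))) with ha_def
  have ha : 0 < a := by positivity
  have ha1 : a ≤ 1 := Real.rpow_le_one_of_one_le_of_nonpos hc.le (by simp; positivity)
  have hac : a ^ (-(d : ℝ) / 2) = c := by
    rw [ha_def, ← Real.rpow_mul hc0.le]
    have : -(2 / (d : ℝ)) * (-(d : ℝ) / 2) = 1 := by field_simp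
    rw [this, Real.rpow_one]
  have hmapR : Measure.map (fun s : ℝ => a • s) volume = ENNReal.ofReal a⁻¹ • volume := by
    rw [Measure.map_addHaar_smul _ ha.ne']
    simp [abs_of_pos ha]
  have hmapE : Measure.map (fun y : EuclideanSpace ℝ (Fin d) => √a • y) volume =
      ENNReal.ofReal (c * 1) • volume := by
    rw [Measure.map_addHaar_smul _ (by positivity)]
    congr 2
    rw [finrank_euclideanSpace_fin, abs_of_pos (by positivity), mul_one, ← hac,
      Real.sqrt_eq_rpow, ← Real.rpow_natCast, ← Real.rpow_mul ha.le, ← Real.rpow_neg ha.le]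
    congr 1
    ring
  set T : ℝ × (EuclideanSpace ℝ (Fin d)) × ℝ → ℝ × (EuclideanSpace ℝ (Fin d)) × ℝ :=
    Prod.map (fun s => a • s) (Prod.map (fun y => √a • y) id) with hT
  have hTm : Measurable T := by
    rw [hT]
    fun_prop
  have hmap : Measure.map T (volume.prod (volume.prod lam)) =
      ENNReal.ofReal (c ^ (1 + 2 / (d : ℝ))) • (volume.prod (volume.prod lam)) := by
    rw [hT, ← Measure.map_prod_map _ _ (by fun_prop) (by fun_prop),
      ← Measure.map_prod_map _ _ (by fun_prop) (by fun_prop), hmapR, hmapE, Measure.map_id,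
      Measure.prod_smul_left, Measure.prod_smul_left, Measure.prod_smul_right, smul_smul,
      ← ENNReal.ofReal_mul (by positivity)]
    congr 2
    rw [Real.rpow_add hc0, Real.rpow_one, ha_def, ← Real.rpow_neg hc0.le, neg_neg]
    ring
  unfold etaBar
  rw [← smul_eq_mul, ← Measure.smul_apply, ← hmap]
  refine le_trans (measure_mono ?_) (Measure.le_map_apply hTm.aemeasurable _)
  rintro ⟨s, y, z⟩ ⟨⟨hs0, hst⟩, hz, hlt⟩
  simp only at hs0 hst hlt hz
  refine ⟨⟨?_, ?_⟩, hz, ?_⟩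
  · exact mul_pos ha hs0
  · exact (mul_le_of_le_one_left hs0.le ha1).trans hst
  · change c * x < heatKernel d κ (a * s) (√a • y) * z
    rw [heatKernel_scaling hκ ha hs0, hac, mul_assoc]
    exact mul_lt_mul_of_pos_left hlt hc0

lemma monotone_volume_heatSection (hκ : 0 < κ) {r : ℝ} :
    Monotone fun z => volume (heatSection d κ t r z) := by
  refine fun z z' h => measure_mono fun p hp => ⟨hp.1, hp.2.trans_le ?_⟩
  have hs : 0 < p.1 := hp.1.1
  refine mul_le_mul_of_nonneg_left h ?_
  unfold heatKernel
  positivity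

lemma volume_heatSection_pos (hd : 1 ≤ d) (hκ : 0 < κ) (ht : 0 < t) {r z : ℝ} (hz : 0 < z) :
    0 < volume (heatSection d κ t r z) := by
  have hd' : (0 : ℝ) < d := by exact_mod_cast hd
  have hlim : Tendsto (fun w : ℝ => w ^ (-(d : ℝ) / 2) * (exp (-1) * z)) (𝓝[>] 0) atTop := by
    refine Tendsto.atTop_mul_const (by positivity) ?_
    rw [neg_div]
    exact tendsto_rpow_neg_nhdsGT_zero (by linarith)
  have hev : ∀ᶠ w : ℝ in 𝓝[>] 0, w < 2 * π * κ * t := by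
    filter_upwards [Ioo_mem_nhdsGT (show (0 : ℝ) < 2 * π * κ * t by positivity)] with w hw
    exact hw.2
  obtain ⟨w, ⟨hwr, hwt⟩, hw0⟩ :=
    (((hlim.eventually_gt_atTop r).and hev).and self_mem_nhdsWithin).exists
  have hw0 : 0 < w := hw0
  set s₀ := w / (2 * π * κ) with hs₀
  have hs₀w : 2 * π * κ * s₀ = w := by rw [hs₀]; field_simp
  have hs₀0 : 0 < s₀ := by positivity
  have hs₀t : s₀ < t := by
    rw [hs₀, div_lt_iff₀ (by positivity)]
    linarith
  have hsub : Ioo (s₀ / 2) s₀ ×ˢ Metric.ball (0 : EuclideanSpace ℝ (Fin d)) √(κ * s₀) ⊆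
      heatSection d κ t r z := by
    rintro ⟨s, y⟩ ⟨⟨hs1, hs2⟩, hy⟩
    simp only at hs1 hs2 hy
    have hs : 0 < s := by linarith
    refine ⟨⟨hs, by simpa using (hs2.trans hs₀t).le⟩, hwr.trans_le ?_⟩
    rw [← mul_assoc]
    refine mul_le_mul_of_nonneg_right ?_ hz.le
    unfold heatKernel
    refine mul_le_mul ?_ ?_ (by positivity) (by positivity)
    · refine Real.rpow_le_rpow_of_nonpos (by positivity) ?_ (by linarith)
      rw [← hs₀w]
      gcongr
    · rw [Real.exp_le_exp, neg_div, neg_le_neg_iff, div_le_one (by positivity)]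
      rw [mem_ball_zero_iff, Real.lt_sqrt (norm_nonneg _)] at hy
      nlinarith
  refine lt_of_lt_of_le ?_ (measure_mono hsub)
  rw [Measure.volume_eq_prod, Measure.prod_prod]
  refine ENNReal.mul_pos ?_ ?_
  · simp only [Real.volume_Ioo, ne_eq, ENNReal.ofReal_eq_zero, not_le]
    linarith
  · exact (Metric.measure_ball_pos _ _ (by positivity)).ne'

lemma volume_heatSection_le {r z S R : ℝ} (hR : 0 ≤ R)
    (h : ∀ s y, s ∈ Ioc 0 t → r < heatKernel d κ s y * z → s ≤ S ∧ ‖y‖ ^ 2 ≤ R) :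
    volume (heatSection d κ t r z) ≤
      ENNReal.ofReal S * (ENNReal.ofReal (R ^ ((d : ℝ) / 2)) *
        volume (Metric.ball (0 : EuclideanSpace ℝ (Fin d)) 1)) := by
  have hsub : heatSection d κ t r z ⊆
      Ioc 0 S ×ˢ Metric.closedBall (0 : EuclideanSpace ℝ (Fin d)) √R := by
    rintro ⟨s, y⟩ ⟨hs, hlt⟩
    obtain ⟨h1, h2⟩ := h s y hs hlt
    refine ⟨⟨hs.1, h1⟩, ?_⟩
    rw [mem_closedBall_zero_iff]
    exact Real.le_sqrt_of_sq_le h2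
  refine (measure_mono hsub).trans_eq ?_
  rw [Measure.volume_eq_prod, Measure.prod_prod, Real.volume_Ioc, sub_zero,
    Measure.addHaar_closedBall _ _ (by positivity), finrank_euclideanSpace_fin,
    Real.sqrt_eq_rpow, ← Real.rpow_natCast, ← Real.rpow_mul hR]
  congr 4
  ring

lemma lintegral_heatSection_Ioc_lt_top (hd : 1 ≤ d) (hκ : 0 < κ) {x : ℝ} (hx : 0 < x)
    (h : ∫⁻ z in Ioc (0 : ℝ) 1, ENNReal.ofReal (z ^ (1 + 2 / (d : ℝ))) ∂lam < ⊤) :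
    ∫⁻ z in Ioc (0 : ℝ) 1, volume (heatSection d κ t x z) ∂lam < ⊤ := by
  have hd' : (0 : ℝ) < d := by exact_mod_cast hd
  set B := volume (Metric.ball (0 : EuclideanSpace ℝ (Fin d)) 1)
  have hB : B < ⊤ := measure_ball_lt_top
  set K : ℝ := (2 * π * κ)⁻¹ * (d / (2 * π)) ^ ((d : ℝ) / 2) * x⁻¹ ^ (1 + 2 / (d : ℝ))
  have hbound : ∀ z ∈ Ioc (0 : ℝ) 1, volume (heatSection d κ t x z) ≤
      ENNReal.ofReal K * B * ENNReal.ofReal (z ^ (1 + 2 / (d : ℝ))) := by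
    rintro z ⟨hz, -⟩
    set v : ℝ := (x / z) ^ (2 / (d : ℝ)) with hv_def
    have hv : 0 < v := by positivity
    have hvd : v ^ ((d : ℝ) / 2) = x / z := by
      rw [hv_def, ← Real.rpow_mul (by positivity)]
      have : 2 / (d : ℝ) * ((d : ℝ) / 2) = 1 := by field_simp
      rw [this, Real.rpow_one]
    have hle := volume_heatSection_le (d := d) (κ := κ) (t := t) (r := x) (z := z)
      (S := (2 * π * κ)⁻¹ * v⁻¹) (R := d / (2 * π) * v⁻¹) (by positivity) (by
        intro s y hs hlt
        have hs0 : 0 < s := hs.1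
        obtain ⟨h1, h2⟩ := bounds_of_lt_heatKernel hd hκ hs0 hv (y := y)
          (by rw [hvd]; rwa [div_lt_iff₀ hz])
        constructor
        · rw [inv_mul_eq_div, le_div_iff₀ (by positivity)]
          linarith
        · rw [div_mul_eq_mul_div, le_div_iff₀ (by positivity)]
          linarith)
    refine hle.trans_eq ?_
    rw [← mul_assoc, ← ENNReal.ofReal_mul (by positivity), mul_right_comm _ B,
      ← ENNReal.ofReal_mul (by positivity)]
    congr 2
    rw [Real.mul_rpow (by positivity) (by positivity), Real.inv_rpow hv.le, hvd]
    have hexp : z ^ (1 + 2 / (d : ℝ)) * x⁻¹ ^ (1 + 2 / (d : ℝ)) = v⁻¹ * (x / z)⁻¹ := by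
      rw [← Real.mul_rpow hz.le (by positivity), ← div_eq_mul_inv, inv_div,
        Real.rpow_add (by positivity), Real.rpow_one, hv_def, ← Real.inv_rpow (by positivity),
        inv_div, mul_comm]
    calc _ = (2 * π * κ)⁻¹ * (d / (2 * π)) ^ ((d : ℝ) / 2) * (v⁻¹ * (x / z)⁻¹) := by ring
      _ = _ := by rw [← hexp]; ring
  refine (setLIntegral_mono' measurableSet_Ioc hbound).trans_lt ?_
  rw [lintegral_const_mul _ (by fun_prop)]
  exact ENNReal.mul_lt_top (ENNReal.mul_lt_top ENNReal.ofReal_lt_top hB) h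

lemma add_rpow_le_two_mul_rpow_add {a b p : ℝ} (ha : 0 ≤ a) (hb : 0 ≤ b) (hp : 0 ≤ p) :
    (a + b) ^ p ≤ (2 * a) ^ p + (2 * b) ^ p := by
  rcases le_total a b with h | h
  · have : (a + b) ^ p ≤ (2 * b) ^ p := Real.rpow_le_rpow (by positivity) (by linarith) hp
    have : 0 ≤ (2 * a) ^ p := by positivity
    linarith
  · have : (a + b) ^ p ≤ (2 * a) ^ p := Real.rpow_le_rpow (by positivity) (by linarith) hp
    have : 0 ≤ (2 * b) ^ p := by positivity
    linarith

lemma lintegral_heatSection_Ioi_lt_top (hκ : 0 < κ) (ht : 0 < t) {x : ℝ} (hx : 0 < x)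
    (hfin : lam (Ioi 1) < ⊤)
    (h : ∫⁻ z in Ioi (1 : ℝ), ENNReal.ofReal (log z ^ ((d : ℝ) / 2)) ∂lam < ⊤) :
    ∫⁻ z in Ioi (1 : ℝ), volume (heatSection d κ t x z) ∂lam < ⊤ := by
  set B := volume (Metric.ball (0 : EuclideanSpace ℝ (Fin d)) 1)
  have hB : B < ⊤ := measure_ball_lt_top
  set a : ℝ := d / (2 * π) + 2 * κ * t * |log x|
  have ha : 0 ≤ a := by positivity
  have hbound : ∀ z ∈ Ioi (1 : ℝ), volume (heatSection d κ t x z) ≤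
      ENNReal.ofReal t * B * (ENNReal.ofReal ((2 * a) ^ ((d : ℝ) / 2)) +
        ENNReal.ofReal ((2 * (2 * κ * t)) ^ ((d : ℝ) / 2)) *
          ENNReal.ofReal (log z ^ ((d : ℝ) / 2))) := by
    intro z hz
    have hz1 : 1 < z := hz
    have hz0 : 0 < z := by linarith
    have hlog : 0 < log z := Real.log_pos hz1
    have hle := volume_heatSection_le (d := d) (κ := κ) (t := t) (r := x) (z := z)
      (S := t) (R := a + 2 * κ * t * log z) (by positivity) (by
        intro s y hs hlt
        refine ⟨hs.2, ?_⟩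
        have h1 := norm_sq_bound_of_lt_heatKernel hκ hs.1 hs.2 (u := x / z) (by positivity)
          (y := y) (by rwa [div_lt_iff₀ hz0])
        have h2 : |log (x / z)| ≤ |log x| + log z := by
          rw [Real.log_div hx.ne' hz0.ne']
          exact (abs_sub _ _).trans_eq (by rw [abs_of_pos hlog])
        have h3 : π * ‖y‖ ^ 2 ≤ π * (a + 2 * κ * t * log z) := by
          calc π * ‖y‖ ^ 2 ≤ d / 2 + 2 * π * κ * t * (|log x| + log z) := h1.trans (by gcongr)
            _ = _ := by
              simp only [a]
              field_simp
              ring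
        exact le_of_mul_le_mul_left h3 Real.pi_pos)
    refine hle.trans ?_
    rw [mul_comm _ B, ← mul_assoc]
    gcongr
    rw [← ENNReal.ofReal_mul (by positivity), ← ENNReal.ofReal_add (by positivity) (by positivity),
      ← Real.mul_rpow (by positivity) hlog.le]
    refine ENNReal.ofReal_le_ofReal ?_
    have := add_rpow_le_two_mul_rpow_add ha (show 0 ≤ 2 * κ * t * log z by positivity)
      (show (0 : ℝ) ≤ d / 2 by positivity)
    rwa [← mul_assoc 2 (2 * κ * t)] at this
  refine (setLIntegral_mono' measurableSet_Ioi hbound).trans_lt ?_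
  rw [lintegral_const_mul _ (by fun_prop), lintegral_add_left (by fun_prop),
    lintegral_const_mul _ (by fun_prop), setLIntegral_const]
  exact ENNReal.mul_lt_top (ENNReal.mul_lt_top ENNReal.ofReal_lt_top hB)
    (ENNReal.add_lt_top.2 ⟨ENNReal.mul_lt_top ENNReal.ofReal_lt_top hfin,
      ENNReal.mul_lt_top ENNReal.ofReal_lt_top h⟩)

lemma IsLevyMeasure.measure_Ioi_one_lt_top (h : IsLevyMeasure lam) : lam (Ioi 1) < ⊤ := by
  refine lt_of_le_of_lt ?_ h.2.2
  calc lam (Ioi 1) = ∫⁻ _ in Ioi (1 : ℝ), 1 ∂lam := by simp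
    _ ≤ ∫⁻ z in Ioi (1 : ℝ), ENNReal.ofReal (min 1 (z ^ 2)) ∂lam := by
      refine setLIntegral_mono' measurableSet_Ioi fun z hz => ?_
      have : (1 : ℝ) < z := hz
      rw [min_eq_left (by nlinarith)]
      simp
    _ ≤ _ := lintegral_mono_set (Ioi_subset_Ioi zero_le_one)

lemma ConditionE.lintegral_rpow_lt_top (hd : 1 ≤ d) (hlam : IsLevyMeasure lam)
    (hE : ConditionE d lam) :
    ∫⁻ z in Ioc (0 : ℝ) 1, ENNReal.ofReal (z ^ (1 + 2 / (d : ℝ))) ∂lam < ⊤ := by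
  by_cases h3 : 3 ≤ d
  · exact hE.2.2.2 h3
  have hd' : (0 : ℝ) < d := by exact_mod_cast hd
  have hd2 : (d : ℝ) ≤ 2 := by exact_mod_cast (show d ≤ 2 by lia)
  have hexp : (2 : ℝ) ≤ 1 + 2 / (d : ℝ) := by
    have : 1 ≤ 2 / (d : ℝ) := by rwa [le_div_iff₀ hd', one_mul]
    linarith
  refine lt_of_le_of_lt ?_ hlam.2.2
  refine (setLIntegral_mono' measurableSet_Ioc fun z hz => ?_).trans
    (lintegral_mono_set Ioc_subset_Ioi_self)
  refine ENNReal.ofReal_le_ofReal ?_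
  rw [min_eq_right (by nlinarith [hz.1, hz.2]), ← Real.rpow_natCast]
  exact Real.rpow_le_rpow_of_exponent_ge hz.1 hz.2 (by exact_mod_cast hexp)

lemma etaBar_pos (hd : 1 ≤ d) (hκ : 0 < κ) (ht : 0 < t) (hlam : IsLevyMeasure lam) (x : ℝ) :
    0 < etaBar d κ t lam x := by
  have := hlam.sFinite
  rw [etaBar_eq_lintegral]
  have hne : lam (Ioi 0) ≠ 0 := by
    intro h
    apply hlam.1
    rw [← Measure.measure_univ_eq_zero, ← Iic_union_Ioi (a := (0 : ℝ))]
    exact measure_union_null hlam.2.1 h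
  rw [setLIntegral_pos_iff (monotone_volume_heatSection hκ).measurable]
  refine (pos_iff_ne_zero.2 hne).trans_le (measure_mono fun z hz => ⟨?_, hz⟩)
  exact (volume_heatSection_pos hd hκ ht hz).ne'

lemma etaBar_lt_top (hd : 1 ≤ d) (hκ : 0 < κ) (ht : 0 < t) (hlam : IsLevyMeasure lam)
    (hE : ConditionE d lam) {x : ℝ} (hx : 0 < x) : etaBar d κ t lam x < ⊤ := by
  have := hlam.sFinite
  rw [etaBar_eq_lintegral, ← Ioc_union_Ioi_eq_Ioi (zero_le_one' ℝ)]
  exact (lintegral_union_le _ _ _).trans_lt (ENNReal.add_lt_top.2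
    ⟨lintegral_heatSection_Ioc_lt_top hd hκ hx (hE.lintegral_rpow_lt_top hd hlam),
      lintegral_heatSection_Ioi_lt_top hκ ht hx hlam.measure_Ioi_one_lt_top hE.1⟩)

/-- Theorem 2.4 (i): under Condition (E), `0 < η̄(x) < ∞` for `x > 0`, and for every
`c > 1`, `c^{-(1+2/d)} ≤ liminf η̄(cx)/η̄(x) ≤ limsup η̄(cx)/η̄(x) ≤ 1`;
in particular `η̄` has extended regular variation. -/
theorem stmt_7 (d : ℕ) (hd : 1 ≤ d) (κ t : ℝ) (hκ : 0 < κ) (ht : 0 < t)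
    (lam : Measure ℝ) (hlam : IsLevyMeasure lam) (hE : ConditionE d lam) :
    (∀ x > (0 : ℝ), 0 < etaBar d κ t lam x ∧ etaBar d κ t lam x < ⊤) ∧
    ∀ c > (1 : ℝ),
      c ^ (-(1 + 2 / (d : ℝ))) ≤
        Filter.liminf (fun x : ℝ =>
          (etaBar d κ t lam (c * x)).toReal / (etaBar d κ t lam x).toReal) atTop ∧
      Filter.liminf (fun x : ℝ =>
          (etaBar d κ t lam (c * x)).toReal / (etaBar d κ t lam x).toReal) atTop ≤
        Filter.limsup (fun x : ℝ =>
          (etaBar d κ t lam (c * x)).toReal / (etaBar d κ t lam x).toReal) atTop ∧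
      Filter.limsup (fun x : ℝ =>
          (etaBar d κ t lam (c * x)).toReal / (etaBar d κ t lam x).toReal) atTop ≤ 1 := by
  refine ⟨fun x hx => ⟨etaBar_pos hd hκ ht hlam x, etaBar_lt_top hd hκ ht hlam hE hx⟩,
    fun c hc => ?_⟩
  have := hlam.sFinite
  have hc0 : 0 < c := by linarith
  have hpos : ∀ x > 0, 0 < (etaBar d κ t lam x).toReal := fun x hx =>
    ENNReal.toReal_pos (etaBar_pos hd hκ ht hlam x).ne' (etaBar_lt_top hd hκ ht hlam hE hx).ne
  set q : ℝ → ℝ := fun x => (etaBar d κ t lam (c * x)).toReal / (etaBar d κ t lam x).toReal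
  have hlow : ∀ᶠ x in atTop, c ^ (-(1 + 2 / (d : ℝ))) ≤ q x := by
    filter_upwards [eventually_gt_atTop 0] with x hx
    have hcx := (etaBar_lt_top hd hκ ht hlam hE (mul_pos hc0 hx)).ne
    have h := ENNReal.toReal_mono (ENNReal.mul_ne_top ENNReal.ofReal_ne_top hcx)
      (etaBar_le_mul (t := t) (lam := lam) (x := x) hd hκ hc)
    rw [ENNReal.toReal_mul, ENNReal.toReal_ofReal (by positivity)] at h
    rw [Real.rpow_neg hc0.le, le_div_iff₀ (hpos x hx), inv_mul_le_iff₀ (by positivity)]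
    exact h
  have hup : ∀ᶠ x in atTop, q x ≤ 1 := by
    filter_upwards [eventually_gt_atTop 0] with x hx
    rw [div_le_one (hpos x hx)]
    exact ENNReal.toReal_mono (etaBar_lt_top hd hκ ht hlam hE hx).ne
      (etaBar_anti (le_mul_of_one_le_left hx.le hc.le))
  have hbelow : IsBoundedUnder (· ≥ ·) atTop q := isBoundedUnder_of_eventually_ge hlow
  have habove : IsBoundedUnder (· ≤ ·) atTop q := isBoundedUnder_of_eventually_le hup
  exact ⟨le_liminf_of_le habove.isCoboundedUnder_ge hlow, liminf_le_limsup habove hbelow,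
    limsup_le_of_le hbelow.isCoboundedUnder_le hup⟩
end
end

section
/- Let λ be a Lévy measure on (0,∞). If d = 1 then ∫_0^t ∫_{(0,∞)} 1{(2πκs)^{-1/2} z > 1} λ(dz) ds = ∫_{(0,∞)} min((2πκ)^{-1} z², t) λ(dz) < ∞ always. If d ≥ 2, then ∫_0^t ∫_{(0,∞)} min(1, (2πκs)^{-d/2} z) λ(dz) ds < ∞ if and only if ∫_{(0,1)} z^{2/d} λ(dz) < ∞ when d ≥ 3, respectively ∫_{(0,1)} z |log z| λ(dz) < ∞ when d = 2. -/
open MeasureTheory Real Filter Set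
open scoped ENNReal Topology

noncomputable section

namespace IsLevyMeasure

variable {lam : Measure ℝ}

theorem measure_Ici_lt_top (h : IsLevyMeasure lam) {δ : ℝ} (hδ : 0 < δ) :
    lam (Ici δ) < ⊤ := by
  have hm : (0 : ℝ) < min 1 (δ ^ 2) := by positivity
  have h1 : ∫⁻ _ in Ici δ, ENNReal.ofReal (min 1 (δ ^ 2)) ∂lam < ⊤ := by
    calc ∫⁻ _ in Ici δ, ENNReal.ofReal (min 1 (δ ^ 2)) ∂lam
        ≤ ∫⁻ z in Ici δ, ENNReal.ofReal (min 1 (z ^ 2)) ∂lam := by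
          refine setLIntegral_mono (by fun_prop) fun z hz => ?_
          have : δ ≤ z := hz
          gcongr
      _ ≤ ∫⁻ z in Ioi 0, ENNReal.ofReal (min 1 (z ^ 2)) ∂lam :=
          lintegral_mono_set (Ici_subset_Ioi.2 hδ)
      _ < ⊤ := h.2.2
  rw [setLIntegral_const] at h1
  exact ENNReal.lt_top_of_mul_ne_top_right h1.ne (ENNReal.ofReal_pos.2 hm).ne'

theorem sigmaFinite_restrict (h : IsLevyMeasure lam) :
    SigmaFinite (lam.restrict (Ioi 0)) := by
  refine ⟨⟨⟨fun n : ℕ => Iic 0 ∪ Ici (1 / ((n : ℝ) + 1)), fun _ => trivial, fun n => ?_, ?_⟩⟩⟩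
  · refine (measure_union_le _ _).trans_lt (ENNReal.add_lt_top.2 ⟨?_, ?_⟩)
    · simp [Measure.restrict_apply measurableSet_Iic, Iic_inter_Ioi]
    · exact (Measure.restrict_apply_le _ _).trans_lt (h.measure_Ici_lt_top (by positivity))
  · refine eq_univ_of_forall fun z => mem_iUnion.2 ?_
    rcases le_or_gt z 0 with hz | hz
    · exact ⟨0, Or.inl hz⟩
    · obtain ⟨n, hn⟩ := exists_nat_one_div_lt hz
      exact ⟨n, Or.inr hn.le⟩

/-- Finiteness of integrals of bounded functions against a Lévy measure depends only on
the order of magnitude of the integrands at `0`. -/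
theorem lintegral_lt_top_of_eventually_le (h : IsLevyMeasure lam) {f g : ℝ → ℝ≥0∞}
    {A C : ℝ≥0∞} (hA : A ≠ ⊤) (hC : C ≠ ⊤) {S T : Set ℝ} (hS : MeasurableSet S)
    (hS0 : S ⊆ Ioi 0) (hT : Ioo 0 1 ⊆ T)
    (hf : ∀ z ∈ S, f z ≤ A) (hfg : ∀ᶠ z in 𝓝[>] (0 : ℝ), f z ≤ C * g z)
    (hg : ∫⁻ z in T, g z ∂lam < ⊤) : ∫⁻ z in S, f z ∂lam < ⊤ := by
  obtain ⟨ε, hε, hεs⟩ := mem_nhdsGT_iff_exists_Ioo_subset.1 hfg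
  set δ := min ε 1
  have hδ : 0 < δ := lt_min hε one_pos
  have hsub : S ⊆ Ioo 0 δ ∪ S ∩ Ici δ := fun z hz => by
    rcases lt_or_ge z δ with hz' | hz'
    · exact Or.inl ⟨hS0 hz, hz'⟩
    · exact Or.inr ⟨hz, hz'⟩
  refine (lintegral_mono_set hsub).trans_lt ((lintegral_union_le _ _ _).trans_lt ?_)
  refine ENNReal.add_lt_top.2 ⟨?_, ?_⟩
  · calc ∫⁻ z in Ioo 0 δ, f z ∂lam ≤ ∫⁻ z in Ioo 0 δ, C * g z ∂lam :=
          setLIntegral_mono' measurableSet_Ioo fun z hz =>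
            hεs ⟨hz.1, hz.2.trans_le (min_le_left _ _)⟩
      _ = C * ∫⁻ z in Ioo 0 δ, g z ∂lam := lintegral_const_mul' _ _ hC
      _ ≤ C * ∫⁻ z in T, g z ∂lam := by
          gcongr
          exact (Ioo_subset_Ioo_right (min_le_right _ _)).trans hT
      _ < ⊤ := ENNReal.mul_lt_top hC.lt_top hg
  · calc ∫⁻ z in S ∩ Ici δ, f z ∂lam ≤ ∫⁻ _ in S ∩ Ici δ, A ∂lam :=
          setLIntegral_mono' (hS.inter measurableSet_Ici) fun z hz => hf z hz.1
      _ = A * lam (S ∩ Ici δ) := setLIntegral_const _ _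
      _ ≤ A * lam (Ici δ) := by gcongr; exact inter_subset_right
      _ < ⊤ := ENNReal.mul_lt_top hA.lt_top (h.measure_Ici_lt_top hδ)

theorem lintegral_lt_top_iff (h : IsLevyMeasure lam) {f g : ℝ → ℝ≥0∞}
    {A B C D : ℝ≥0∞} (hA : A ≠ ⊤) (hB : B ≠ ⊤) (hC : C ≠ ⊤) (hD : D ≠ ⊤)
    (hf : ∀ z ∈ Ioi (0 : ℝ), f z ≤ A) (hg : ∀ z ∈ Ioo (0 : ℝ) 1, g z ≤ B)
    (hfg : ∀ᶠ z in 𝓝[>] (0 : ℝ), f z ≤ C * g z) (hgf : ∀ᶠ z in 𝓝[>] (0 : ℝ), g z ≤ D * f z) :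
    ∫⁻ z in Ioi 0, f z ∂lam < ⊤ ↔ ∫⁻ z in Ioo 0 1, g z ∂lam < ⊤ :=
  ⟨h.lintegral_lt_top_of_eventually_le hB hD measurableSet_Ioo Ioo_subset_Ioi_self
    Ioo_subset_Ioi_self hg hgf,
   h.lintegral_lt_top_of_eventually_le hA hC measurableSet_Ioi subset_rfl subset_rfl hf hfg⟩

end IsLevyMeasure

/-- The time integral of the truncated on-diagonal heat kernel at jump size `z`. -/
def truncatedTimeIntegral (c p t z : ℝ) : ℝ≥0∞ :=
  ∫⁻ s in Ioc 0 t, ENNReal.ofReal (min 1 ((c * s) ^ (-p) * z))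

theorem truncatedTimeIntegral_le (c p t z : ℝ) :
    truncatedTimeIntegral c p t z ≤ ENNReal.ofReal t := by
  calc truncatedTimeIntegral c p t z ≤ ∫⁻ _ in Ioc 0 t, 1 :=
        lintegral_mono fun s => ENNReal.ofReal_le_one.2 (min_le_left _ _)
    _ = ENNReal.ofReal t := by simp

theorem truncatedTimeIntegral_eq {c p t z : ℝ} (hc : 0 < c) (hp : 0 < p) (hz : 0 < z)
    (ht : z ^ p⁻¹ / c ≤ t) :
    truncatedTimeIntegral c p t z = ENNReal.ofReal (z ^ p⁻¹ / c) +
      ∫⁻ s in Ioc (z ^ p⁻¹ / c) t, ENNReal.ofReal ((c * s) ^ (-p) * z) := by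
  set a := z ^ p⁻¹ / c with ha
  have ha0 : 0 < a := by positivity
  have hca : (c * a) ^ p = z := by
    rw [ha, mul_div_cancel₀ _ hc.ne', rpow_inv_rpow hz.le hp.ne']
  rw [truncatedTimeIntegral, ← Ioc_union_Ioc_eq_Ioc ha0.le ht,
    lintegral_union measurableSet_Ioc (Ioc_disjoint_Ioc_of_le le_rfl)]
  congr 1
  · calc _ = ∫⁻ _ in Ioc 0 a, 1 := by
          refine setLIntegral_congr_fun measurableSet_Ioc fun s hs => ?_
          have hs0 := hs.1
          have : (1 : ℝ) ≤ (c * s) ^ (-p) * z := by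
            rw [rpow_neg (by positivity), ← div_eq_inv_mul, one_le_div (by positivity), ← hca]
            gcongr
            exact hs.2
          simp [min_eq_left this]
      _ = _ := by simp
  · refine setLIntegral_congr_fun measurableSet_Ioc fun s hs => ?_
    have hs0 := ha0.trans hs.1
    have : (c * s) ^ (-p) * z ≤ 1 := by
      rw [rpow_neg (by positivity), ← div_eq_inv_mul, div_le_one (by positivity), ← hca]
      gcongr
      exact hs.1.le
    simp only [min_eq_right this]

theorem truncatedTimeIntegral_le_of_one_lt {c p t z : ℝ} (hc : 0 < c) (hp : 1 < p) (hz : 0 < z)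
    (ht : z ^ p⁻¹ / c ≤ t) :
    truncatedTimeIntegral c p t z ≤
      ENNReal.ofReal (c⁻¹ * (1 + (p - 1)⁻¹)) * ENNReal.ofReal (z ^ p⁻¹) := by
  have hp0 : 0 < p := by linarith
  have hp1 : 0 < p - 1 := by linarith
  rw [truncatedTimeIntegral_eq hc hp0 hz ht]
  set a := z ^ p⁻¹ / c with ha
  have ha0 : 0 < a := by positivity
  have hca : (c * a) ^ p = z := by
    rw [ha, mul_div_cancel₀ _ hc.ne', rpow_inv_rpow hz.le hp0.ne']
  have hint : IntegrableOn (fun s : ℝ => c ^ (-p) * z * s ^ (-p)) (Ioi a) :=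
    (integrableOn_Ioi_rpow_of_lt (by linarith) ha0).const_mul _
  have htail : ∫⁻ s in Ioc a t, ENNReal.ofReal ((c * s) ^ (-p) * z) ≤
      ENNReal.ofReal (a / (p - 1)) := by
    calc _ ≤ ∫⁻ s in Ioi a, ENNReal.ofReal ((c * s) ^ (-p) * z) :=
          lintegral_mono_set Ioc_subset_Ioi_self
      _ = ∫⁻ s in Ioi a, ENNReal.ofReal (c ^ (-p) * z * s ^ (-p)) := by
          refine setLIntegral_congr_fun measurableSet_Ioi fun s hs => ?_
          have hs0 : 0 < s := ha0.trans hs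
          simp only [mul_rpow hc.le hs0.le]
          ring_nf
      _ = ENNReal.ofReal (∫ s in Ioi a, c ^ (-p) * z * s ^ (-p)) := by
          refine (ofReal_integral_eq_lintegral_ofReal hint ?_).symm
          filter_upwards [ae_restrict_mem measurableSet_Ioi] with s hs
          have hs0 : 0 < s := ha0.trans hs
          simp only [Pi.zero_apply]
          positivity
      _ = ENNReal.ofReal (a / (p - 1)) := by
          rw [integral_const_mul, integral_Ioi_rpow_of_lt (by linarith) ha0]
          congr 1
          have h1 : a ^ (-p + 1) = a ^ (-p) * a := by rw [rpow_add_one ha0.ne']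
          have h2 : c ^ (-p) * a ^ (-p) * z = 1 := by
            rw [← mul_rpow hc.le ha0.le, rpow_neg (by positivity), hca,
              inv_mul_cancel₀ hz.ne']
          rw [h1, show -p + 1 = -(p - 1) by ring, neg_div_neg_eq]
          linear_combination (a / (p - 1)) * h2
  refine (add_le_add_right htail _).trans (le_of_eq ?_)
  rw [← ENNReal.ofReal_add ha0.le (by positivity), ← ENNReal.ofReal_mul (by positivity), ha]
  congr 1
  field_simp

theorem le_truncatedTimeIntegral {c p t z : ℝ} (hc : 0 < c) (hp : 0 < p) (hz : 0 < z)
    (ht : z ^ p⁻¹ / c ≤ t) :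
    ENNReal.ofReal (z ^ p⁻¹) ≤ ENNReal.ofReal c * truncatedTimeIntegral c p t z := by
  calc ENNReal.ofReal (z ^ p⁻¹) = ENNReal.ofReal c * ENNReal.ofReal (z ^ p⁻¹ / c) := by
        rw [← ENNReal.ofReal_mul hc.le, mul_div_cancel₀ _ hc.ne']
    _ ≤ _ := by
        rw [truncatedTimeIntegral_eq hc hp hz ht]
        gcongr
        exact le_self_add

theorem truncatedTimeIntegral_one {c t z : ℝ} (hc : 0 < c) (hz : 0 < z) (ht : z / c ≤ t) :
    truncatedTimeIntegral c 1 t z =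
      ENNReal.ofReal (c⁻¹ * (z * (1 + Real.log (c * t) - Real.log z))) := by
  have ha0 : 0 < z / c := by positivity
  have ht0 : 0 < t := ha0.trans_le ht
  have h := truncatedTimeIntegral_eq hc one_pos hz (by simpa using ht)
  simp only [inv_one, rpow_one] at h
  have hint : IntegrableOn (fun s : ℝ => z / c * (1 / s)) (Ioc (z / c) t) := by
    refine (intervalIntegrable_iff_integrableOn_Ioc_of_le ht).1 ?_
    refine (intervalIntegral.intervalIntegrable_one_div (fun s hs => ?_) (by fun_prop)).const_mul _
    rw [uIcc_of_le ht] at hs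
    exact (ha0.trans_le hs.1).ne'
  have htail : ∫⁻ s in Ioc (z / c) t, ENNReal.ofReal ((c * s) ^ (-1 : ℝ) * z) =
      ENNReal.ofReal (z / c * Real.log (t / (z / c))) := by
    calc _ = ∫⁻ s in Ioc (z / c) t, ENNReal.ofReal (z / c * (1 / s)) := by
          refine setLIntegral_congr_fun measurableSet_Ioc fun s hs => ?_
          have hs0 : 0 < s := ha0.trans hs.1
          simp only [rpow_neg_one]
          congr 1
          field_simp
      _ = ENNReal.ofReal (∫ s in Ioc (z / c) t, z / c * (1 / s)) := by
          refine (ofReal_integral_eq_lintegral_ofReal hint ?_).symm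
          filter_upwards [ae_restrict_mem measurableSet_Ioc] with s hs
          have hs0 : 0 < s := ha0.trans hs.1
          simp only [Pi.zero_apply]
          positivity
      _ = _ := by
          rw [integral_const_mul, ← intervalIntegral.integral_of_le ht,
            integral_one_div_of_pos ha0 ht0]
  have hlog : 0 ≤ Real.log (t / (z / c)) := Real.log_nonneg ((one_le_div ha0).2 ht)
  rw [h, htail, ← ENNReal.ofReal_add ha0.le (by positivity),
    show t / (z / c) = c * t / z by field_simp, Real.log_div (by positivity) hz.ne']
  congr 1
  field_simp
  ring

theorem tendsto_rpow_nhdsGT_zero {q : ℝ} (hq : 0 < q) :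
    Tendsto (fun z : ℝ => z ^ q) (𝓝[>] 0) (𝓝 0) := by
  have := (continuousAt_rpow_const 0 q (Or.inr hq.le)).tendsto
  rw [zero_rpow hq.ne'] at this
  exact this.mono_left nhdsWithin_le_nhds

theorem lintegral_truncatedTimeIntegral_lt_top_iff_of_one_lt {lam : Measure ℝ}
    (h : IsLevyMeasure lam) {c p t : ℝ} (hc : 0 < c) (hp : 1 < p) (ht : 0 < t) :
    ∫⁻ z in Ioi 0, truncatedTimeIntegral c p t z ∂lam < ⊤ ↔
      ∫⁻ z in Ioo 0 1, ENNReal.ofReal (z ^ p⁻¹) ∂lam < ⊤ := by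
  have hp0 : 0 < p := by linarith
  have hsmall : ∀ᶠ z : ℝ in 𝓝[>] 0, z ^ p⁻¹ / c ≤ t := by
    have := (tendsto_rpow_nhdsGT_zero (inv_pos.2 hp0)).div_const c
    rw [zero_div] at this
    exact this.eventually_le_const ht
  refine h.lintegral_lt_top_iff ENNReal.ofReal_ne_top ENNReal.one_ne_top ENNReal.ofReal_ne_top
    ENNReal.ofReal_ne_top (fun z _ => truncatedTimeIntegral_le c p t z) (fun z hz => ?_)
    (C := ENNReal.ofReal (c⁻¹ * (1 + (p - 1)⁻¹))) (D := ENNReal.ofReal c) ?_ ?_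
  · exact ENNReal.ofReal_le_one.2 (rpow_le_one hz.1.le hz.2.le (by positivity))
  · filter_upwards [hsmall, self_mem_nhdsWithin] with z hzt hz
    exact truncatedTimeIntegral_le_of_one_lt hc hp hz hzt
  · filter_upwards [hsmall, self_mem_nhdsWithin] with z hzt hz
    exact le_truncatedTimeIntegral hc hp0 hz hzt

theorem lintegral_truncatedTimeIntegral_one_lt_top_iff {lam : Measure ℝ}
    (h : IsLevyMeasure lam) {c t : ℝ} (hc : 0 < c) (ht : 0 < t) :
    ∫⁻ z in Ioi 0, truncatedTimeIntegral c 1 t z ∂lam < ⊤ ↔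
      ∫⁻ z in Ioo 0 1, ENNReal.ofReal (z * |Real.log z|) ∂lam < ⊤ := by
  have hsmall : ∀ᶠ z : ℝ in 𝓝[>] 0, z / c ≤ t := by
    have := (tendsto_id.mono_left (nhdsWithin_le_nhds (a := (0 : ℝ)) (s := Ioi 0))).div_const c
    rw [zero_div] at this
    exact this.eventually_le_const ht
  have hlog := tendsto_log_nhdsGT_zero.eventually_le_atBot (-(2 * (1 + |Real.log (c * t)|)))
  refine h.lintegral_lt_top_iff ENNReal.ofReal_ne_top ENNReal.one_ne_top ENNReal.ofReal_ne_top
    ENNReal.ofReal_ne_top (fun z _ => truncatedTimeIntegral_le c 1 t z) (fun z hz => ?_)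
    (C := ENNReal.ofReal (c⁻¹ * 2)) (D := ENNReal.ofReal (2 * c)) ?_ ?_
  · have := Real.abs_log_mul_self_lt z hz.1 hz.2.le
    rw [abs_mul, abs_of_pos hz.1, mul_comm] at this
    exact ENNReal.ofReal_le_one.2 this.le
  all_goals
    filter_upwards [hsmall, hlog, self_mem_nhdsWithin] with z hzt hzl hz
    have hz : 0 < z := hz
    have h1 := le_abs_self (Real.log (c * t))
    have h2 := neg_abs_le (Real.log (c * t))
    rw [truncatedTimeIntegral_one hc hz hzt, ← ENNReal.ofReal_mul (by positivity),
      abs_of_nonpos (by linarith)]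
    refine ENNReal.ofReal_le_ofReal ?_
  · rw [mul_assoc]
    refine mul_le_mul_of_nonneg_left ?_ (by positivity)
    nlinarith
  · have : 2 * c * (c⁻¹ * (z * (1 + Real.log (c * t) - Real.log z))) =
        z * (2 * (1 + Real.log (c * t) - Real.log z)) := by field_simp
    rw [this]
    refine mul_le_mul_of_nonneg_left ?_ hz.le
    linarith

theorem setLIntegral_indicator_rpow {c t z : ℝ} (hc : 0 < c) (hz : 0 < z) :
    ∫⁻ s in Ioc 0 t, (if 1 < (c * s) ^ (-(1 : ℝ) / 2) * z then (1 : ℝ≥0∞) else 0) =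
      ENNReal.ofReal (min (c⁻¹ * z ^ 2) t) := by
  have hiff : ∀ s ∈ Ioc 0 t, (1 < (c * s) ^ (-(1 : ℝ) / 2) * z ↔ s < c⁻¹ * z ^ 2) := by
    intro s hs
    have hs0 := hs.1
    rw [neg_div, rpow_neg (by positivity), ← div_eq_inv_mul, one_lt_div (by positivity),
      ← Real.sqrt_eq_rpow, Real.sqrt_lt' hz, ← div_eq_inv_mul, lt_div_iff₀ hc, mul_comm c]
  calc _ = ∫⁻ s in Ioc 0 t, (Iio (c⁻¹ * z ^ 2)).indicator 1 s := by
        refine setLIntegral_congr_fun measurableSet_Ioc fun s hs => ?_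
        simp only [hiff s hs, indicator, mem_Iio, Pi.one_apply]
    _ = volume (Iio (c⁻¹ * z ^ 2) ∩ Ioc 0 t) := by
        rw [lintegral_indicator_one measurableSet_Iio, Measure.restrict_apply measurableSet_Iio]
    _ = _ := by
        rcases le_or_gt (c⁻¹ * z ^ 2) t with hle | hlt
        · rw [min_eq_left hle, show Iio (c⁻¹ * z ^ 2) ∩ Ioc 0 t = Ioo 0 (c⁻¹ * z ^ 2) by
            ext s
            simp only [mem_inter_iff, mem_Iio, mem_Ioc, mem_Ioo]
            exact ⟨fun hs => ⟨hs.2.1, hs.1⟩, fun hs => ⟨hs.2, hs.1, hs.2.le.trans hle⟩⟩]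
          simp
        · rw [min_eq_right hlt.le, inter_eq_right.2 fun s hs => hs.2.trans_lt hlt]
          simp

/-- Theorem 3.1 existence computation: if `d = 1` then
`∫_0^t ∫ 1{(2πκs)^{-1/2} z > 1} λ(dz) ds = ∫ min((2πκ)^{-1} z², t) λ(dz) < ∞` always;
if `d ≥ 2` then `∫_0^t ∫ min(1, (2πκs)^{-d/2} z) λ(dz) ds < ∞` iff
`∫_{(0,1)} z^{2/d} λ(dz) < ∞` when `d ≥ 3`, resp. `∫_{(0,1)} z |log z| λ(dz) < ∞`
when `d = 2`. -/
theorem stmt_10 (d : ℕ) (hd : 1 ≤ d) (κ t : ℝ) (hκ : 0 < κ) (ht : 0 < t)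
    (lam : Measure ℝ) (hlam : IsLevyMeasure lam) :
    (d = 1 →
      (∫⁻ s in Set.Ioc (0 : ℝ) t, ∫⁻ z in Set.Ioi (0 : ℝ),
          (if 1 < (2 * π * κ * s) ^ (-(1 : ℝ) / 2) * z then 1 else 0) ∂lam) =
        (∫⁻ z in Set.Ioi (0 : ℝ),
          ENNReal.ofReal (min ((2 * π * κ)⁻¹ * z ^ 2) t) ∂lam) ∧
      (∫⁻ z in Set.Ioi (0 : ℝ),
          ENNReal.ofReal (min ((2 * π * κ)⁻¹ * z ^ 2) t) ∂lam) < ⊤) ∧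
    (2 ≤ d →
      ((∫⁻ s in Set.Ioc (0 : ℝ) t, ∫⁻ z in Set.Ioi (0 : ℝ),
          ENNReal.ofReal (min 1 ((2 * π * κ * s) ^ (-(d : ℝ) / 2) * z)) ∂lam) < ⊤ ↔
        ((3 ≤ d → ∫⁻ z in Set.Ioo (0 : ℝ) 1,
            ENNReal.ofReal (z ^ ((2 : ℝ) / d)) ∂lam < ⊤) ∧
         (d = 2 → ∫⁻ z in Set.Ioo (0 : ℝ) 1,
            ENNReal.ofReal (z * |Real.log z|) ∂lam < ⊤)))) := by
  have hc : 0 < 2 * π * κ := by positivity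
  have := hlam.sigmaFinite_restrict
  refine ⟨fun _ => ⟨?_, ?_⟩, fun hd2 => ?_⟩
  · rw [lintegral_lintegral_swap]
    · exact setLIntegral_congr_fun measurableSet_Ioi fun z hz => setLIntegral_indicator_rpow hc hz
    · refine (Measurable.ite (measurableSet_lt measurable_const ?_) measurable_const
        measurable_const).aemeasurable
      fun_prop
  · refine hlam.lintegral_lt_top_of_eventually_le (A := ENNReal.ofReal t)
      (C := ENNReal.ofReal (2 * π * κ)⁻¹) ENNReal.ofReal_ne_top ENNReal.ofReal_ne_top
      measurableSet_Ioi subset_rfl Ioo_subset_Ioi_self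
      (fun z _ => ENNReal.ofReal_le_ofReal (min_le_right _ _)) ?_ hlam.2.2
    filter_upwards [Ioo_mem_nhdsGT one_pos] with z hz
    rw [← ENNReal.ofReal_mul (by positivity), min_eq_right (pow_le_one₀ hz.1.le hz.2.le)]
    exact ENNReal.ofReal_le_ofReal (min_le_left _ _)
  · have hswap : ∫⁻ s in Ioc 0 t, ∫⁻ z in Ioi 0,
        ENNReal.ofReal (min 1 ((2 * π * κ * s) ^ (-(d : ℝ) / 2) * z)) ∂lam =
        ∫⁻ z in Ioi 0, truncatedTimeIntegral (2 * π * κ) (d / 2) t z ∂lam := by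
      rw [lintegral_lintegral_swap (by fun_prop)]
      simp only [truncatedTimeIntegral, neg_div]
    rw [hswap]
    rcases hd2.eq_or_lt with rfl | hd3
    · simpa using lintegral_truncatedTimeIntegral_one_lt_top_iff hlam hc ht
    · have hp : (1 : ℝ) < d / 2 := by
        have : (3 : ℝ) ≤ d := by exact_mod_cast hd3
        linarith
      rw [lintegral_truncatedTimeIntegral_lt_top_iff_of_one_lt hlam hc hp ht, inv_div]
      exact ⟨fun h => ⟨fun _ => h, fun h2 => by omega⟩, fun h => h.1 hd3⟩
end
end
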